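/- arXiv:1504.01377 — 9 statements merged into one kernel-verified Lean document; each statement's English description precedes it below -/
import Mathlib

section
/- Let s and r be natural numbers, let x_0, …, x_{min(s,r)} be arbitrary real numbers, and let A = A^{s+r,s} be the associated symmetric diagram matrix. Then every real eigenvalue of A belongs to the set {λ_l : 0 ≤ l ≤ min(s,r)}; that is, if v is a nonzero real vector with A·v = μ·v for some real μ, then μ = λ_l for some 0 ≤ l ≤ min(s,r). -/
open Finset in
/-- A binomial identity read off from `((1 + Y) - Y (1 + X)) ^ l = (1 - X Y) ^ l`. -/
theorem sum_neg_one_pow_choose_mul_choose_add (p q l t u : ℕ) :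
    ∑ a ∈ range (l + 1), (-1 : ℝ) ^ a * (l.choose a : ℝ) *
        (if a ≤ u then ((p + a).choose t * (q + (l - a)).choose (u - a) : ℝ) else 0) =
      ∑ j ∈ range (l + 1), (-1 : ℝ) ^ j * (l.choose j : ℝ) *
        (if j ≤ t ∧ j ≤ u then (p.choose (t - j) * q.choose (u - j) : ℝ) else 0) := by
  let X₁ : Polynomial (Polynomial ℝ) := Polynomial.C Polynomial.X
  let X₂ : Polynomial (Polynomial ℝ) := Polynomial.X
  have key : ∑ a ∈ range (l + 1), Polynomial.C ((1 + Polynomial.X) ^ (p + a) *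
        Polynomial.C ((-1) ^ a * (l.choose a : ℝ))) * (X₂ ^ a * (1 + X₂) ^ (q + (l - a))) =
      ∑ j ∈ range (l + 1), Polynomial.C (Polynomial.X ^ j * ((1 + Polynomial.X) ^ p *
        Polynomial.C ((-1) ^ j * (l.choose j : ℝ)))) * (X₂ ^ j * (1 + X₂) ^ q) := by
    have h : (1 + X₁) ^ p * (1 + X₂) ^ q * (-(X₂ * (1 + X₁)) + (1 + X₂)) ^ l =
        (1 + X₁) ^ p * (1 + X₂) ^ q * (-(X₁ * X₂) + 1) ^ l := by
      congr 2; ring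
    rw [add_pow (-(X₂ * (1 + X₁))), add_pow (-(X₁ * X₂)), mul_sum, mul_sum] at h
    convert h using 2 with a _ a _
    · simp only [X₁, map_mul, map_pow, map_add, map_one, map_neg, map_natCast,
        neg_pow (X₂ * _), mul_pow, pow_add]
      ring
    · simp only [X₁, map_mul, map_pow, map_add, map_one, map_neg, map_natCast,
        neg_pow (_ * X₂), mul_pow, one_pow]
      ring
  have h := congrArg (fun P => (P.coeff u).coeff t) key
  simp only [Polynomial.finsetSum_coeff, Polynomial.coeff_C_mul, X₂,
    Polynomial.coeff_X_pow_mul', Polynomial.coeff_one_add_X_pow, mul_ite, mul_zero,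
    apply_ite (fun P : Polynomial ℝ => P.coeff t), Polynomial.coeff_zero] at h
  simp only [← Polynomial.C_eq_natCast, Polynomial.coeff_mul_C, Polynomial.coeff_X_pow_mul',
    Polynomial.coeff_one_add_X_pow] at h
  convert h using 2 with a _ a _
  · split_ifs <;> ring
  · by_cases hu : a ≤ u <;> by_cases ht : a ≤ t <;> simp only [hu, ht, and_self, and_true,
      and_false, if_true, if_false] <;> ring

section Johnson

open Finset

variable {α : Type*} [Fintype α] [DecidableEq α] {s : ℕ}

/-- The number of `s`-sets `S ⊇ L` with `|S \ T| = t`, for a fixed `s`-set `T`. -/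
theorem card_superset_sdiff_eq (L T : Finset α) (hT : T.card = s) (t : ℕ) :
    #{S : {S : Finset α // S.card = s} | L ⊆ S.val ∧ (S.val \ T).card = t} =
      if (L \ T).card ≤ t then
        (T \ L).card.choose t * (Tᶜ \ L).card.choose (t - (L \ T).card) else 0 := by
  split_ifs with h
  · rw [← card_powersetCard t (T \ L), ← card_powersetCard _ (Tᶜ \ L), ← card_product]
    have hcard : ∀ Q P : Finset α, Q ⊆ T \ L → #Q = t → P ⊆ Tᶜ \ L → #P = t - #(L \ T) →
        #((T \ Q) ∪ ((L \ T) ∪ P)) = s := by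
      intro Q P hQ hQt hP hPt
      have h1 : Disjoint (L \ T) P := by
        rw [disjoint_left]; intro a; have := @hP a; simp at *; tauto
      have h2 : Disjoint (T \ Q) ((L \ T) ∪ P) := by
        rw [disjoint_left]; intro a; have := @hP a; simp at *; tauto
      have h3 : Q ⊆ T := hQ.trans sdiff_subset
      have := card_le_card h3
      rw [card_union_of_disjoint h2, card_union_of_disjoint h1, card_sdiff_of_subset h3]
      omega
    refine card_bij' (fun S _ => (T \ S.val, (S.val \ T) \ L))
      (fun QP h => ⟨(T \ QP.1) ∪ ((L \ T) ∪ QP.2), ?_⟩) ?_ ?_ ?_ ?_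
    · simp only [mem_product, mem_powersetCard] at h
      exact hcard _ _ h.1.1 h.1.2 h.2.1 h.2.2
    · rintro ⟨S, hS⟩ hL
      simp only [mem_filter, mem_univ, true_and] at hL
      simp only [mem_product, mem_powersetCard]
      refine ⟨⟨sdiff_subset_sdiff subset_rfl hL.1, ?_⟩, ?_, ?_⟩
      · rw [← hL.2, card_sdiff_comm (hT.trans hS.symm)]
      · intro a; simp; tauto
      · have : (S \ T) \ L = (S \ T) \ (L \ T) := by ext a; simp; tauto
        rw [this, card_sdiff_of_subset (sdiff_subset_sdiff hL.1 subset_rfl), hL.2]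
    · rintro ⟨Q, P⟩ hQP
      simp only [mem_product, mem_powersetCard] at hQP
      obtain ⟨⟨hQ, hQt⟩, hP, hPt⟩ := hQP
      simp only [mem_filter, mem_univ, true_and]
      constructor
      · intro a ha
        have := @hQ a
        simp at *; tauto
      · rw [card_sdiff_comm ((hcard Q P hQ hQt hP hPt).trans hT.symm), ← hQt]
        congr 1
        ext a
        have h1 := @hQ a
        have h2 := @hP a
        simp at *; tauto
    · rintro ⟨S, hS⟩ hL
      simp only [mem_filter, mem_univ, true_and] at hL
      ext a
      have := @hL.1 a
      simp at *; tauto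
    · rintro ⟨Q, P⟩ hQP
      simp only [mem_product, mem_powersetCard] at hQP
      obtain ⟨⟨hQ, -⟩, hP, -⟩ := hQP
      ext a <;> have h1 := @hQ a <;> have h2 := @hP a <;> simp at * <;> tauto
  · rw [card_eq_zero, filter_eq_empty_iff]
    rintro S - ⟨hL, rfl⟩
    exact h (card_le_card (sdiff_subset_sdiff hL subset_rfl))

/-- If all sums of `v` over the supersets of a set with fewer than `l` elements vanish, then sums
of `v` over the sets containing `M` and avoiding `K` reduce to sums over supersets. -/
theorem sum_disjoint_superset (v : {S : Finset α // S.card = s} → ℝ) (l : ℕ)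
    (h0 : ∀ M : Finset α, M.card < l → ∑ T with M ⊆ T.val, v T = 0)
    (K M : Finset α) (hKM : Disjoint K M) (hl : K.card + M.card ≤ l) :
    ∑ T with Disjoint K T.val ∧ M ⊆ T.val, v T =
      if K.card + M.card = l then (-1) ^ K.card * ∑ T with K ∪ M ⊆ T.val, v T else 0 := by
  induction K using Finset.induction_on generalizing M with
  | empty =>
    simp only [card_empty, zero_add, empty_union, disjoint_empty_left, true_and, pow_zero,
      one_mul] at *
    split_ifs with h
    · rfl
    · exact h0 M (by omega)
  | insert i K hi ih =>
    rw [disjoint_insert_left] at hKM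
    rw [card_insert_of_notMem hi] at hl ⊢
    have h1 := ih M hKM.2 (by omega)
    rw [if_neg (by omega)] at h1
    have h2 := ih (insert i M) (disjoint_insert_right.2 ⟨hi, hKM.2⟩)
      (by rw [card_insert_of_notMem hKM.1]; omega)
    rw [card_insert_of_notMem hKM.1] at h2
    have h3 : ∑ T : {S : Finset α // S.card = s} with Disjoint K T.val ∧ M ⊆ T.val, v T =
        ∑ T with Disjoint (insert i K) T.val ∧ M ⊆ T.val, v T +
        ∑ T with Disjoint K T.val ∧ insert i M ⊆ T.val, v T := by
      simp only [sum_filter, ← sum_add_distrib]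
      refine sum_congr rfl fun T _ => ?_
      simp only [disjoint_insert_left, insert_subset_iff]
      by_cases hiT : i ∈ T.val <;> simp [hiT]
    rw [eq_sub_of_add_eq h3.symm, h1, h2, zero_sub, union_insert, insert_union]
    have e : K.card + 1 + M.card = K.card + (M.card + 1) := by omega
    rw [e]
    split_ifs
    · ring
    · simp

/-- Pairing such a `v` with a function of `|L \ T|`, where `|L| = l`. -/
theorem sum_mul_card_sdiff (v : {S : Finset α // S.card = s} → ℝ) (L : Finset α)
    (h0 : ∀ M : Finset α, M.card < L.card → ∑ T with M ⊆ T.val, v T = 0) (g : ℕ → ℝ) :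
    ∑ T, v T * g (L \ T.val).card =
      (∑ a ∈ range (L.card + 1), (-1) ^ a * (L.card.choose a : ℝ) * g a) *
        ∑ T with L ⊆ T.val, v T := by
  have h1 : ∑ T : {S : Finset α // S.card = s}, v T * g (L \ T.val).card =
      ∑ K ∈ L.powerset, (-1) ^ K.card * g K.card * ∑ T with L ⊆ T.val, v T := by
    rw [← sum_fiberwise_of_maps_to (s := univ) (t := L.powerset)
      (g := fun T : {S : Finset α // S.card = s} => L \ T.val)
      (fun T _ => mem_powerset.2 sdiff_subset)]
    refine sum_congr rfl fun K hK => ?_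
    rw [mem_powerset] at hK
    have hc := card_sdiff_add_card_eq_card hK
    have h2 := sum_disjoint_superset v L.card h0 K (L \ K) disjoint_sdiff (by omega)
    rw [if_pos (by omega), union_sdiff_of_subset hK] at h2
    rw [mul_right_comm, ← h2, sum_mul]
    refine sum_congr ?_ fun T hT => ?_
    · ext T
      simp only [mem_filter, mem_univ, true_and]
      constructor
      · rintro rfl
        refine ⟨sdiff_disjoint, fun a => ?_⟩
        simp
      · rintro ⟨hd, hs⟩
        ext a
        have h1 := @hs a
        have h2 := @hK a
        have h3 := @disjoint_left.1 hd a
        simp at *; tauto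
    · simp only [mem_filter, mem_univ, true_and] at hT
      have hKT : L \ T.val = K := by
        ext a
        have h1 := @hT.2 a
        have h2 := @hK a
        have h3 := @disjoint_left.1 hT.1 a
        simp at *; tauto
      rw [hKT]
  rw [h1, ← sum_mul, sum_powerset_apply_card (fun a => (-1 : ℝ) ^ a * g a)]
  congr 1
  refine sum_congr rfl fun a _ => ?_
  rw [nsmul_eq_mul]; ring

end Johnson

/-- Every real eigenvalue of the symmetric diagram matrix `A^{s+r,s}` is one of the
values `λ_l` for `0 ≤ l ≤ min s r`. -/
theorem stmt_0 (s r : ℕ) (x : ℕ → ℝ)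
    (A : Matrix {S : Finset (Fin (s + r)) // S.card = s}
                {S : Finset (Fin (s + r)) // S.card = s} ℝ)
    (hA : ∀ S T, A S T = x (min s r - (S.val \ T.val).card))
    (μ : ℝ) (v : {S : Finset (Fin (s + r)) // S.card = s} → ℝ)
    (hv : v ≠ 0) (heig : A.mulVec v = μ • v) :
    ∃ l ≤ min s r, μ =
      ∑ t ∈ Finset.range (min s r + 1),
        (∑ j ∈ Finset.range (l + 1),
          (-1 : ℝ) ^ j * (l.choose j : ℝ) *
            (if j ≤ t then ((s - l).choose (t - j) * (r - l).choose (t - j) : ℝ) else 0)) *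
        x (min s r - t) := by
  classical
  obtain ⟨L, hL, hmin⟩ : ∃ L : Finset (Fin (s + r)), ∑ T with L ⊆ T.val, v T ≠ 0 ∧
      ∀ M : Finset (Fin (s + r)), M.card < L.card → ∑ T with M ⊆ T.val, v T = 0 := by
    have hex : ∃ L : Finset (Fin (s + r)), ∑ T with L ⊆ T.val, v T ≠ 0 := by
      obtain ⟨S, hS⟩ := Function.ne_iff.1 hv
      refine ⟨S.val, ?_⟩
      rw [Finset.sum_eq_single_of_mem S (by simp)]
      · exact hS
      · intro T hT hTS
        simp only [Finset.mem_filter, Finset.mem_univ, true_and] at hT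
        exact absurd (Subtype.ext (Finset.eq_of_subset_of_card_le hT
          (by rw [T.2, S.2])).symm) hTS
    obtain ⟨L, hL, hmin⟩ := exists_minimalFor_of_wellFoundedLT
      (fun L : Finset (Fin (s + r)) => ∑ T with L ⊆ T.val, v T ≠ 0) Finset.card hex
    refine ⟨L, hL, fun M hM => ?_⟩
    by_contra h
    exact absurd (hmin h hM.le) (by omega)
  have hcompl : ∀ T : {S : Finset (Fin (s + r)) // S.card = s}, T.valᶜ.card = r := by
    intro T
    rw [Finset.card_compl, T.2, Fintype.card_fin]; omega
  have hls : L.card ≤ s := by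
    obtain ⟨T, hT, -⟩ := Finset.exists_ne_zero_of_sum_ne_zero hL
    exact (Finset.card_le_card (Finset.mem_filter.1 hT).2).trans_eq T.2
  have hlr : L.card ≤ r := by
    have h := sum_disjoint_superset v L.card hmin L ∅ (by simp) (by simp)
    rw [if_pos (by simp), Finset.union_empty] at h
    obtain ⟨T, hT, -⟩ := Finset.exists_ne_zero_of_sum_ne_zero
      (h.trans_ne (mul_ne_zero (by simp) hL))
    exact (Finset.card_le_card (Finset.subset_compl_iff_disjoint_right.2
      (Finset.mem_filter.1 hT).2.1)).trans_eq (hcompl T)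
  refine ⟨L.card, le_min hls hlr, ?_⟩
  set m := min s r with hm
  have hinner : ∀ T : {S : Finset (Fin (s + r)) // S.card = s},
      ∑ S with L ⊆ S.val, A S T = (fun a => ∑ t ∈ Finset.range (m + 1),
        (if a ≤ t then ((s - L.card + a).choose t *
          (r - L.card + (L.card - a)).choose (t - a) : ℝ) else 0) * x (m - t))
        (L \ T.val).card := by
    intro T
    have h1 : ∀ S, A S T = ∑ t ∈ Finset.range (m + 1),
        if (S.val \ T.val).card = t then x (m - t) else 0 := by
      intro S
      have h2 : (S.val \ T.val).card ≤ s :=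
        (Finset.card_le_card Finset.sdiff_subset).trans_eq S.2
      have h3 : (S.val \ T.val).card ≤ r := by
        exact (Finset.card_le_card fun a => by simp).trans_eq (hcompl T)
      rw [hA, Finset.sum_ite_eq, if_pos (Finset.mem_range.2 (by omega))]
    have hLT : (L \ T.val).card + (T.val ∩ L).card = L.card := by
      rw [Finset.inter_comm, Finset.card_sdiff_add_card_inter]
    have hTL : (T.val \ L).card + (T.val ∩ L).card = s := by
      rw [Finset.card_sdiff_add_card_inter, T.2]
    have hTcL : (T.valᶜ \ L).card + (L \ T.val).card = r := by
      have e : L \ T.val = T.valᶜ ∩ L := by ext a; simp; tauto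
      rw [e, Finset.card_sdiff_add_card_inter, hcompl T]
    simp only [h1]
    rw [Finset.sum_comm]
    refine Finset.sum_congr rfl fun t _ => ?_
    rw [← Finset.sum_filter, Finset.filter_filter, Finset.sum_const, nsmul_eq_mul,
      card_superset_sdiff_eq L T.val T.2 t]
    have e1 : (T.val \ L).card = s - L.card + (L \ T.val).card := by omega
    have e2 : (T.valᶜ \ L).card = r - L.card + (L.card - (L \ T.val).card) := by omega
    rw [e1, e2]
    push_cast
    rfl
  have hsum : ∑ S with L ⊆ S.val, A.mulVec v S = μ * ∑ T with L ⊆ T.val, v T := by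
    simp [heig, Finset.mul_sum]
  simp only [Matrix.mulVec, dotProduct] at hsum
  rw [Finset.sum_comm] at hsum
  simp only [mul_comm _ (v _), ← Finset.mul_sum, hinner] at hsum
  have hpair := sum_mul_card_sdiff v L hmin (fun a => ∑ t ∈ Finset.range (m + 1),
        (if a ≤ t then ((s - L.card + a).choose t *
          (r - L.card + (L.card - a)).choose (t - a) : ℝ) else 0) * x (m - t))
  rw [← mul_right_cancel₀ hL (hpair.symm.trans hsum)]
  simp only [Finset.mul_sum]
  rw [Finset.sum_comm]
  refine Finset.sum_congr rfl fun t _ => ?_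
  simp only [← mul_assoc]
  rw [← Finset.sum_mul, sum_neg_one_pow_choose_mul_choose_add]
  simp only [and_self]
end

section
/- Let s and r be natural numbers, let x_0, …, x_{min(s,r)} be arbitrary real numbers, and let A = A^{s+r,s} be the associated symmetric diagram matrix. Then for every 0 ≤ l ≤ min(s,r), λ_l is an eigenvalue of A; that is, there exists a nonzero real vector v indexed by the s-element subsets of {1,…,s+r} with A·v = λ_l·v. -/
/-- The product over `i ∈ I` of the differences of the indicators of `a i` and `b i`. -/
def pairProd {ι α : Type*} [DecidableEq α] (R : Type*) [CommRing R] (I : Finset ι) (a b : ι → α)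
    (T : Finset α) : R :=
  ∏ i ∈ I, ((if a i ∈ T then 1 else 0) - (if b i ∈ T then 1 else 0))

section

variable {ι α : Type*} [DecidableEq α]

theorem pairProd_congr {R : Type*} [CommRing R] {I : Finset ι} {a b : ι → α} {T T' : Finset α}
    (h : ∀ i ∈ I, (a i ∈ T ↔ a i ∈ T') ∧ (b i ∈ T ↔ b i ∈ T')) :
    pairProd R I a b T = pairProd R I a b T' :=
  Finset.prod_congr rfl fun i hi => by simp only [(h i hi).1, (h i hi).2]

theorem sum_powerset_insert_mul_prod {R : Type*} [CommRing R] {V : Finset α} {c : α} (hc : c ∉ V)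
    (g : Finset α → R) (w u : α → R) :
    ∑ T ∈ (insert c V).powerset, g T * ((∏ e ∈ T, w e) * ∏ e ∈ insert c V \ T, u e) =
      ∑ T ∈ V.powerset, (g T * u c + g (insert c T) * w c) *
        ((∏ e ∈ T, w e) * ∏ e ∈ V \ T, u e) := by
  rw [Finset.sum_powerset_insert hc, ← Finset.sum_add_distrib]
  refine Finset.sum_congr rfl fun T hT => ?_
  have hcT : c ∉ T := fun h => hc (Finset.mem_powerset.1 hT h)
  rw [Finset.insert_sdiff_of_notMem _ hcT, Finset.prod_insert (by simp [hc]),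
    Finset.prod_insert hcT, Finset.insert_sdiff_insert, Finset.sdiff_insert_of_notMem hc]
  ring

theorem sum_powerset_pairProd {R : Type*} [CommRing R] [DecidableEq ι] (I : Finset ι)
    (a b : ι → α) (ha : Function.Injective a) (hb : Function.Injective b)
    (hab : ∀ i j, a i ≠ b j) (U : Finset α) (haU : ∀ i, a i ∉ U) (hbU : ∀ i, b i ∉ U)
    (w u : α → R) :
    ∑ T ∈ (U ∪ (I.image a ∪ I.image b)).powerset, pairProd R I a b T *
        ((∏ e ∈ T, w e) * ∏ e ∈ (U ∪ (I.image a ∪ I.image b)) \ T, u e) =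
      (∏ i ∈ I, (w (a i) * u (b i) - w (b i) * u (a i))) * ∏ e ∈ U, (w e + u e) := by
  induction I using Finset.induction_on with
  | empty => simp [pairProd, Finset.prod_add]
  | insert i I hi ih =>
    set V := U ∪ (I.image a ∪ I.image b) with hV
    have hset : U ∪ ((insert i I).image a ∪ (insert i I).image b) =
        insert (a i) (insert (b i) V) := by
      ext e
      simp only [hV, Finset.image_insert, Finset.mem_union, Finset.mem_insert]
      tauto
    have hbV : b i ∉ V := by
      simp only [hV, Finset.mem_union, Finset.mem_image, hbU, false_or, hab, and_false,
        exists_false, not_exists, not_and]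
      intro j hj h
      exact hi (hb h ▸ hj)
    have haV : a i ∉ V := by
      simp only [hV, Finset.mem_union, Finset.mem_image, haU, false_or, (hab _ _).symm, and_false,
        exists_false, or_false, not_exists, not_and]
      intro j hj h
      exact hi (ha h ▸ hj)
    have haV' : a i ∉ insert (b i) V := by simp [hab, haV]
    rw [hset, sum_powerset_insert_mul_prod haV', sum_powerset_insert_mul_prod hbV,
      Finset.prod_insert hi, mul_assoc, ← ih, Finset.mul_sum]
    refine Finset.sum_congr rfl fun T hT => ?_
    have haT : a i ∉ T := fun h => haV (Finset.mem_powerset.1 hT h)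
    have hbT : b i ∉ T := fun h => hbV (Finset.mem_powerset.1 hT h)
    have ne (j) (hj : j ∈ I) : j ≠ i := fun h => hi (h ▸ hj)
    have h1 : pairProd R I a b (insert (a i) T) = pairProd R I a b T :=
      pairProd_congr fun j hj => by simp [ha.eq_iff, ne j hj, (hab _ _).symm]
    have h2 : pairProd R I a b (insert (b i) T) = pairProd R I a b T :=
      pairProd_congr fun j hj => by simp [hb.eq_iff, ne j hj, hab]
    have h3 : pairProd R I a b (insert (a i) (insert (b i) T)) = pairProd R I a b T :=
      pairProd_congr fun j hj => by simp [ha.eq_iff, hb.eq_iff, ne j hj, hab, (hab _ _).symm]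
    have key (T' : Finset α) : pairProd R (insert i I) a b T' =
        ((if a i ∈ T' then 1 else 0) - (if b i ∈ T' then 1 else 0)) * pairProd R I a b T' :=
      Finset.prod_insert hi
    simp only [key, h1, h2, h3]
    simp [haT, hbT, hab, (hab _ _).symm]
    ring

theorem card_inter_of_pairProd_ne_zero {R : Type*} [CommRing R] [Fintype ι] [DecidableEq ι]
    {a b : ι → α} (ha : Function.Injective a) (hb : Function.Injective b)
    (hab : ∀ i j, a i ≠ b j) {S : Finset α} (hS : pairProd R Finset.univ a b S ≠ 0) :
    ((Finset.univ.image a ∪ Finset.univ.image b) ∩ S).card = Fintype.card ι := by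
  have hd : Disjoint (Finset.univ.image a ∩ S) (Finset.univ.image b ∩ S) := by
    refine Finset.disjoint_left.2 fun e h1 h2 => ?_
    simp only [Finset.mem_inter, Finset.mem_image, Finset.mem_univ, true_and] at h1 h2
    obtain ⟨⟨i, rfl⟩, -⟩ := h1
    obtain ⟨⟨j, hj⟩, -⟩ := h2
    exact hab i j hj.symm
  have hsep (i : ι) : b i ∈ S ↔ a i ∉ S := by
    by_contra h
    refine hS (Finset.prod_eq_zero (Finset.mem_univ i) ?_)
    by_cases h1 : a i ∈ S <;> by_cases h2 : b i ∈ S <;> simp_all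
  rw [Finset.union_inter_distrib_right, Finset.card_union_of_disjoint hd]
  have e1 : Finset.univ.image a ∩ S = (Finset.univ.filter fun i => a i ∈ S).image a := by
    ext e; simp only [Finset.mem_inter, Finset.mem_image, Finset.mem_filter]; aesop
  have e2 : Finset.univ.image b ∩ S = (Finset.univ.filter fun i => ¬ a i ∈ S).image b := by
    simp only [← hsep]
    ext e; simp only [Finset.mem_inter, Finset.mem_image, Finset.mem_filter]; aesop
  rw [e1, e2, Finset.card_image_of_injective _ ha, Finset.card_image_of_injective _ hb,
    Finset.card_filter_add_card_filter_not, Finset.card_univ]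

/-- Generating function of `pairProd` over all subsets `T`, counting `S \ T` and `T \ S`. -/
theorem sum_pairProd_mul_pow {R : Type*} [CommRing R] [Fintype α] [Fintype ι] [DecidableEq ι]
    {a b : ι → α} (ha : Function.Injective a) (hb : Function.Injective b)
    (hab : ∀ i j, a i ≠ b j) (S : Finset α) (y z : R) :
    ∑ T : Finset α, pairProd R Finset.univ a b T * (y ^ (S \ T).card * z ^ (T \ S).card) =
      pairProd R Finset.univ a b S * ((1 - y * z) ^ Fintype.card ι *
        ((1 + y) ^ (S.card - Fintype.card ι) * (1 + z) ^ (Sᶜ.card - Fintype.card ι))) := by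
  set P := Finset.univ.image a ∪ Finset.univ.image b with hP
  have h := sum_powerset_pairProd Finset.univ a b ha hb hab Pᶜ (by simp [hP]) (by simp [hP])
    (fun e => if e ∈ S then 1 else z) (fun e => if e ∈ S then y else 1)
  rw [← hP, show Pᶜ ∪ P = Finset.univ by rw [Finset.union_comm, Finset.union_compl],
    Finset.powerset_univ] at h
  have hT (T : Finset α) : y ^ (S \ T).card * z ^ (T \ S).card =
      (∏ e ∈ T, if e ∈ S then 1 else z) * ∏ e ∈ Finset.univ \ T, if e ∈ S then y else 1 := by
    rw [Finset.prod_ite, Finset.prod_ite]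
    simp only [Finset.prod_const, one_pow, one_mul, mul_one]
    rw [mul_comm]
    congr 3 <;> ext e <;> simp [and_comm]
  simp only [hT, h]
  have hpair (i : ι) : ((if a i ∈ S then 1 else z) * (if b i ∈ S then y else 1) -
      (if b i ∈ S then 1 else z) * (if a i ∈ S then y else 1)) =
      ((if a i ∈ S then 1 else 0) - (if b i ∈ S then 1 else 0)) * (1 - y * z) := by
    split_ifs <;> ring
  simp only [hpair, Finset.prod_mul_distrib, Finset.prod_const, Finset.card_univ]
  change pairProd R Finset.univ a b S * _ * _ = _
  by_cases hS : pairProd R Finset.univ a b S = 0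
  · simp [hS]
  have hcard := card_inter_of_pairProd_ne_zero ha hb hab hS
  rw [← hP] at hcard
  have hPc : P.card = 2 * Fintype.card ι := by
    rw [hP, Finset.card_union_of_disjoint, Finset.card_image_of_injective _ ha,
      Finset.card_image_of_injective _ hb, Finset.card_univ, two_mul]
    refine Finset.disjoint_left.2 fun e h1 h2 => ?_
    simp only [Finset.mem_image, Finset.mem_univ, true_and] at h1 h2
    obtain ⟨i, rfl⟩ := h1
    obtain ⟨j, hj⟩ := h2
    exact hab i j hj.symm
  have hU : (∏ e ∈ Pᶜ, ((if e ∈ S then 1 else z) + if e ∈ S then y else 1)) =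
      (1 + y) ^ (S \ P).card * (1 + z) ^ (Sᶜ \ P).card := by
    have hc (e : α) : ((if e ∈ S then 1 else z) + if e ∈ S then y else 1) =
        if e ∈ S then 1 + y else 1 + z := by split_ifs <;> ring
    simp only [hc, Finset.prod_ite, Finset.prod_const]
    congr 3 <;> ext e <;> simp [and_comm]
  have c1 : (S \ P).card = S.card - Fintype.card ι := by
    rw [Finset.card_sdiff, hcard]
  have c2 : (Sᶜ \ P).card = Sᶜ.card - Fintype.card ι := by
    have := Finset.card_inter_add_card_sdiff P S
    have e : P ∩ Sᶜ = P \ S := by ext; simp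
    rw [Finset.card_sdiff, e]
    omega
  rw [hU, c1, c2, mul_assoc]

open Polynomial in
theorem coeff_coeff_one_sub_mul_pow (l m n t : ℕ) :
    (((1 - X * C X : ℝ[X][X]) ^ l * ((1 + X) ^ m * (1 + C X) ^ n)).coeff t).coeff t =
      ∑ j ∈ Finset.range (l + 1), (-1 : ℝ) ^ j * (l.choose j : ℝ) *
        (if j ≤ t then (m.choose (t - j) * n.choose (t - j) : ℝ) else 0) := by
  have h : (1 - X * C X : ℝ[X][X]) ^ l * ((1 + X) ^ m * (1 + C X) ^ n) =
      ∑ j ∈ Finset.range (l + 1), X ^ j * (C (C ((-1 : ℝ) ^ j * (l.choose j : ℝ)) *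
        (X ^ j * (1 + X) ^ n)) * (1 + X) ^ m) := by
    rw [sub_eq_neg_add, add_pow, Finset.sum_mul]
    refine Finset.sum_congr rfl fun j _ => ?_
    simp only [map_mul, map_pow, map_add, map_neg, map_one, map_natCast, one_pow]
    rw [neg_eq_neg_one_mul (X * C X : ℝ[X][X]), mul_pow, mul_pow]
    ring
  rw [h, finsetSum_coeff, finsetSum_coeff]
  refine Finset.sum_congr rfl fun j _ => ?_
  rw [coeff_X_pow_mul']
  split_ifs with hj
  · rw [coeff_C_mul, coeff_one_add_X_pow, ← C_eq_natCast, coeff_mul_C, coeff_C_mul,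
      coeff_X_pow_mul', if_pos hj, coeff_one_add_X_pow]
    ring
  · simp

open Polynomial in
/-- The vector `pairProd` is an eigenvector of each relation of the Johnson scheme. -/
theorem sum_pairProd_filter [Fintype α] [Fintype ι] [DecidableEq ι]
    {a b : ι → α} (ha : Function.Injective a) (hb : Function.Injective b)
    (hab : ∀ i j, a i ≠ b j) (S : Finset α) (t : ℕ) :
    ∑ T : Finset α with (S \ T).card = t ∧ (T \ S).card = t, pairProd ℝ Finset.univ a b T =
      pairProd ℝ Finset.univ a b S * ∑ j ∈ Finset.range (Fintype.card ι + 1),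
        (-1 : ℝ) ^ j * ((Fintype.card ι).choose j : ℝ) *
        (if j ≤ t then ((S.card - Fintype.card ι).choose (t - j) *
          (Sᶜ.card - Fintype.card ι).choose (t - j) : ℝ) else 0) := by
  have h := congrArg (fun p : ℝ[X][X] => (p.coeff t).coeff t)
    (sum_pairProd_mul_pow ha hb hab S (X : ℝ[X][X]) (C X))
  have hC (T : Finset α) : pairProd ℝ[X][X] Finset.univ a b T =
      C (C (pairProd ℝ Finset.univ a b T)) := by
    simp only [pairProd, map_prod, map_sub]
    refine Finset.prod_congr rfl fun i _ => ?_
    split_ifs <;> simp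
  simp only [hC, finsetSum_coeff, coeff_C_mul, coeff_coeff_one_sub_mul_pow] at h
  rw [← h, Finset.sum_filter]
  refine Finset.sum_congr rfl fun T _ => ?_
  rw [← C_pow, coeff_mul_C, coeff_X_pow]
  by_cases h1 : t = (S \ T).card
  · by_cases h2 : t = (T \ S).card
    · simp [← h1, ← h2]
    · simp [← h1, coeff_X_pow, h2, Ne.symm h2]
  · simp [h1, Ne.symm h1]

end


/-- For every `0 ≤ l ≤ min s r`, the value `λ_l` is an eigenvalue of the symmetric
diagram matrix `A^{s+r,s}`. -/
theorem stmt_1 (s r : ℕ) (x : ℕ → ℝ)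
    (A : Matrix {S : Finset (Fin (s + r)) // S.card = s}
                {S : Finset (Fin (s + r)) // S.card = s} ℝ)
    (hA : ∀ S T, A S T = x (min s r - (S.val \ T.val).card)) :
    ∀ l ≤ min s r, ∃ v : {S : Finset (Fin (s + r)) // S.card = s} → ℝ,
      v ≠ 0 ∧ A.mulVec v =
        (∑ t ∈ Finset.range (min s r + 1),
          (∑ j ∈ Finset.range (l + 1),
            (-1 : ℝ) ^ j * (l.choose j : ℝ) *
              (if j ≤ t then ((s - l).choose (t - j) * (r - l).choose (t - j) : ℝ) else 0)) *
          x (min s r - t)) • v := by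
  intro l hl
  have hls : l ≤ s := hl.trans (min_le_left _ _)
  have hlr : l ≤ r := hl.trans (min_le_right _ _)
  let a : Fin l → Fin (s + r) := fun i => ⟨i, by omega⟩
  let b : Fin l → Fin (s + r) := fun i => ⟨l + i, by omega⟩
  have ha : Function.Injective a := fun i j h => by
    simp only [a, Fin.mk.injEq] at h; exact Fin.ext h
  have hb : Function.Injective b := fun i j h => by
    simp only [b, Fin.mk.injEq] at h; exact Fin.ext (by omega)
  have hab (i j) : a i ≠ b j := fun h => by
    simp only [a, b, Fin.mk.injEq] at h; omega
  refine ⟨fun S => pairProd ℝ Finset.univ a b S.val, ?_, ?_⟩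
  · obtain ⟨S, h1, h2, hS⟩ := Finset.exists_subsuperset_card_eq (n := s)
      (s := Finset.univ.image a) (t := (Finset.univ.image b)ᶜ)
      (fun e he => by
        simp only [Finset.mem_image, Finset.mem_univ, true_and, Finset.mem_compl] at he ⊢
        rintro ⟨j, rfl⟩
        obtain ⟨i, hi⟩ := he
        exact hab i j hi)
      (by rw [Finset.card_image_of_injective _ ha]; simpa using hls)
      (by rw [Finset.card_compl, Finset.card_image_of_injective _ hb]; simp; omega)
    intro h0
    have h3 := congrFun h0 ⟨S, hS⟩
    have haS (i) : a i ∈ S := h1 (Finset.mem_image_of_mem _ (Finset.mem_univ i))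
    have hbS (i) : b i ∉ S := fun h =>
      Finset.mem_compl.1 (h2 h) (Finset.mem_image_of_mem _ (Finset.mem_univ i))
    simp [pairProd, haS, hbS] at h3
  · funext S
    obtain ⟨S, hS⟩ := S
    have hSc : Sᶜ.card = r := by rw [Finset.card_compl, hS]; simp
    have hcard {T : Finset (Fin (s + r))} (hT : T.card = s) : (T \ S).card = (S \ T).card :=
      Finset.card_sdiff_comm (hT.trans hS.symm)
    have hle {T : Finset (Fin (s + r))} (hT : T.card = s) : (S \ T).card ≤ min s r := by
      refine le_min ((Finset.card_le_card Finset.sdiff_subset).trans_eq hS) ?_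
      rw [← hcard hT]
      exact (Finset.card_le_card fun e he => by simp_all).trans_eq hSc
    have hmem (t : ℕ) (T : Finset (Fin (s + r))) :
        ((S \ T).card = t ∧ (T \ S).card = t) ↔ (T.card = s ∧ (S \ T).card = t) := by
      have h1 := Finset.card_sdiff_add_card_inter S T
      have h2 := Finset.card_sdiff_add_card_inter T S
      rw [Finset.inter_comm] at h2
      omega
    have key (t : ℕ) := sum_pairProd_filter ha hb hab S t
    simp only [hS, hSc, Fintype.card_fin, hmem] at key
    simp only [Matrix.mulVec, dotProduct, hA, Pi.smul_apply, smul_eq_mul]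
    rw [Finset.sum_mul]
    refine (Finset.sum_subtype (p := fun T : Finset (Fin (s + r)) => T.card = s)
      (Finset.univ.filter fun T => T.card = s) (by simp)
      (fun T => x (min s r - (S \ T).card) * pairProd ℝ Finset.univ a b T)).symm.trans ?_
    rw [← Finset.sum_fiberwise_of_maps_to (t := Finset.range (min s r + 1))
      (g := fun T => (S \ T).card)
      (fun T hT => Finset.mem_range.2 (Nat.lt_succ_of_le (hle (by simpa using hT))))]
    refine Finset.sum_congr rfl fun t _ => ?_
    rw [mul_right_comm, mul_comm _ (pairProd ℝ Finset.univ a b S), ← key, mul_comm,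
      Finset.mul_sum, Finset.filter_filter]
    refine Finset.sum_congr rfl fun T hT => ?_
    rw [(Finset.mem_filter.1 hT).2.2]
end

section
/- Let s and r be natural numbers, let x_0, …, x_{min(s,r)} be arbitrary real numbers, and let A = A^{s+r,s} be the associated symmetric diagram matrix. Then the matrix product Π_{l=0}^{min(s,r)} (A − λ_l·I) is the zero matrix, where I is the identity matrix of size C(s+r,s); in other words, the monic polynomial Π_{l=0}^{min(s,r)} (X − λ_l) annihilates A. -/
open Finset in
/-- A bivariate generating function for the supersets `T` of `U`, weighted by
`x ^ #(S \ T) * y ^ #(T \ S)`. -/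
lemma sum_superset_pow_sdiff {α R : Type*} [Fintype α] [DecidableEq α] [CommRing R]
    (S U : Finset α) (x y : R) :
    ∑ T : Finset α, (if U ⊆ T then x ^ (S \ T).card * y ^ (T \ S).card else 0) =
      (1 + x) ^ (S \ U).card * (1 + y) ^ (Sᶜ \ U).card * y ^ (U \ S).card := by
  have h : ∏ a : α, ((if a ∈ S then 1 else y) + (if a ∈ U then 0 else if a ∈ S then x else 1)) =
      (1 + x) ^ (S \ U).card * (1 + y) ^ (Sᶜ \ U).card * y ^ (U \ S).card := by
    have e : ∀ a : α, ((if a ∈ S then 1 else y) +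
        (if a ∈ U then 0 else if a ∈ S then x else 1)) =
        (if a ∈ S \ U then 1 + x else 1) * (if a ∈ Sᶜ \ U then 1 + y else 1) *
          (if a ∈ U \ S then y else 1) := by
      intro a
      by_cases h1 : a ∈ S <;> by_cases h2 : a ∈ U <;> simp [h1, h2, add_comm]
    simp only [e, prod_mul_distrib, prod_ite_mem, univ_inter, prod_const]
  rw [← h, prod_add, powerset_univ]
  refine sum_congr rfl fun T _ => ?_
  have h1 : ∏ a ∈ T, (if a ∈ S then (1 : R) else y) = y ^ (T \ S).card := by
    rw [prod_ite, prod_const_one, one_mul, prod_const, filter_notMem_eq_sdiff]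
  rw [h1]
  split_ifs with hU
  · have h2 : ∀ a ∈ univ \ T, (if a ∈ U then (0 : R) else if a ∈ S then x else 1) =
        if a ∈ S then x else 1 := by
      intro a ha
      rw [if_neg fun h => (mem_sdiff.1 ha).2 (hU h)]
    rw [prod_congr rfl h2, prod_ite_mem, prod_const, mul_comm]
    congr 3
    ext a
    simp [and_comm]
  · obtain ⟨a, ha, haT⟩ := not_subset.1 hU
    rw [prod_eq_zero (i := a) (by simp [haT]) (by simp [ha]), mul_zero]

open Finset in
/-- The generating function of `sum_superset_pow_sdiff`, expanded in terms of the indicators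
of `J ⊆ S` for `J ⊆ U`. -/
lemma sum_superset_pow_sdiff_eq_sum_powerset {α R : Type*} [Fintype α] [DecidableEq α]
    [CommRing R] {s r : ℕ} (hα : Fintype.card α = s + r) {S U : Finset α} (hS : S.card = s)
    (hs : U.card ≤ s) (hr : U.card ≤ r) (x y : R) :
    ∑ T : Finset α, (if U ⊆ T then x ^ (S \ T).card * y ^ (T \ S).card else 0) =
      ∑ J ∈ U.powerset, if J ⊆ S then
        (1 + x) ^ (s - U.card) * (1 + y) ^ (r - U.card) *
          ((1 - x * y) ^ J.card * (y * (1 + x)) ^ (U \ J).card) else 0 := by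
  have h : ∏ a ∈ U, ((if a ∈ S then 1 - x * y else 0) + y * (1 + x)) =
      (1 + y) ^ (U ∩ S).card * (y * (1 + x)) ^ (U \ S).card := by
    have e : ∀ a : α, ((if a ∈ S then 1 - x * y else 0) + y * (1 + x)) =
        if a ∈ S then 1 + y else y * (1 + x) := by
      intro a
      split_ifs <;> ring
    simp only [e]
    rw [prod_ite, prod_const, prod_const, filter_notMem_eq_sdiff, filter_mem_eq_inter]
  have h1 : (S \ U).card = (s - U.card) + (U \ S).card := by
    have := card_sdiff_add_card_inter S U
    have := card_sdiff_add_card_inter U S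
    rw [inter_comm] at this
    omega
  have h2 : (Sᶜ \ U).card = (r - U.card) + (U ∩ S).card := by
    have a1 := card_sdiff_add_card_inter Sᶜ U
    have a2 := card_sdiff_add_card_inter U S
    have a3 := card_compl S
    have a4 : Sᶜ ∩ U = U \ S := by ext; simp [and_comm]
    rw [a4] at a1
    omega
  rw [sum_superset_pow_sdiff, h1, h2]
  calc _ = (1 + x) ^ (s - U.card) * (1 + y) ^ (r - U.card) *
        ((1 + y) ^ (U ∩ S).card * (y * (1 + x)) ^ (U \ S).card) := by
        rw [mul_pow]
        ring
    _ = _ := by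
      rw [← h, prod_add, mul_sum]
      refine sum_congr rfl fun J _ => ?_
      rw [prod_const]
      split_ifs with hJ
      · rw [prod_congr rfl fun a ha => if_pos (hJ ha), prod_const]
      · obtain ⟨a, ha, haS⟩ := not_subset.1 hJ
        rw [prod_eq_zero ha (if_neg haS)]
        ring

open Polynomial in
/-- The linear functional sending `X ^ a * Y ^ b` to `x (m - a)` if `a = b ≤ m`, and to `0`
otherwise. -/
noncomputable def diagonalFunctional (m : ℕ) (x : ℕ → ℝ) : ℝ[X][X] →ₗ[ℝ] ℝ :=
  ∑ t ∈ Finset.range (m + 1),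
    x (m - t) • (lcoeff ℝ t ∘ₗ (lcoeff ℝ[X] t).restrictScalars ℝ)

open Polynomial in
lemma diagonalFunctional_apply (m : ℕ) (x : ℕ → ℝ) (p : ℝ[X][X]) :
    diagonalFunctional m x p =
      ∑ t ∈ Finset.range (m + 1), (p.coeff t).coeff t * x (m - t) := by
  simp [diagonalFunctional, mul_comm]

open Polynomial in
lemma diagonalFunctional_monomial (m : ℕ) (x : ℕ → ℝ) (a b : ℕ) :
    diagonalFunctional m x (C X ^ a * X ^ b) = if a = b ∧ a ≤ m then x (m - a) else 0 := by
  have h : ∀ t, (((C X : ℝ[X][X]) ^ a * X ^ b).coeff t).coeff t =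
      if t = a then (if a = b then 1 else 0) else 0 := by
    intro t
    rw [← C_pow, coeff_C_mul, coeff_X_pow]
    by_cases h1 : t = b
    · subst h1
      by_cases h2 : t = a
      · simp [h2]
      · simp [h2, coeff_X_pow]
    · by_cases h2 : t = a
      · subst h2; simp [h1]
      · simp [h1, h2]
  rw [diagonalFunctional_apply]
  simp only [h]
  by_cases hab : a = b <;> simp [hab]

open Polynomial in
lemma diagonalFunctional_eigenvalue (m : ℕ) (x : ℕ → ℝ) (a b l : ℕ) :
    diagonalFunctional m x ((1 + C X) ^ a * (1 + X) ^ b * (1 - C X * X) ^ l) =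
      ∑ t ∈ Finset.range (m + 1), (∑ j ∈ Finset.range (l + 1),
          (-1 : ℝ) ^ j * (l.choose j : ℝ) *
            (if j ≤ t then (a.choose (t - j) * b.choose (t - j) : ℝ) else 0)) * x (m - t) := by
  rw [diagonalFunctional_apply]
  refine Finset.sum_congr rfl fun t _ => ?_
  congr 1
  have h : ((1 + C X) ^ a * (1 + X) ^ b * (1 - C X * X) ^ l : ℝ[X][X]) =
      ∑ j ∈ Finset.range (l + 1), C (C ((-1 : ℝ) ^ j * (l.choose j : ℝ)) * ((1 + X) ^ a * X ^ j)) *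
        ((1 + X) ^ b * X ^ j) := by
    rw [sub_eq_add_neg, add_comm (1 : ℝ[X][X]) (-_),
      add_pow (-(C X * X)), Finset.mul_sum]
    refine Finset.sum_congr rfl fun j _ => ?_
    simp only [one_pow, mul_one, C_mul, C_pow, C_add, C_neg, C_1, map_natCast,
      neg_pow (C X * X : ℝ[X][X]), mul_pow]
    ring
  rw [h, finsetSum_coeff, finsetSum_coeff]
  refine Finset.sum_congr rfl fun j _ => ?_
  rw [coeff_C_mul, coeff_mul_X_pow', mul_assoc, mul_assoc, coeff_C_mul]
  split_ifs with hj
  · rw [coeff_one_add_X_pow, ← mul_assoc ((1 + X) ^ a), coeff_mul_natCast, coeff_mul_X_pow', if_pos hj, coeff_one_add_X_pow]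
  · simp

/-- The function on the `s`-element subsets of `α` indicating whether they contain `U`. -/
def supersetIndicator {α : Type*} [DecidableEq α] (s : ℕ) (U : Finset α) :
    {S : Finset α // S.card = s} → ℝ :=
  fun S => if U ⊆ S.val then 1 else 0

open Polynomial in
lemma mulVec_supersetIndicator {α : Type*} [Fintype α] [DecidableEq α] {s r : ℕ}
    (hα : Fintype.card α = s + r) (x : ℕ → ℝ)
    (A : Matrix {S : Finset α // S.card = s} {S : Finset α // S.card = s} ℝ)
    (hA : ∀ S T, A S T = x (min s r - (S.val \ T.val).card))
    {U : Finset α} (hs : U.card ≤ s) (hr : U.card ≤ r) :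
    A.mulVec (supersetIndicator s U) =
      ∑ J ∈ U.powerset, diagonalFunctional (min s r) x
        ((1 + C X) ^ (s - U.card) * (1 + X) ^ (r - U.card) *
          ((1 - C X * X) ^ J.card * (X * (1 + C X)) ^ (U \ J).card)) •
        supersetIndicator s J := by
  ext ⟨S, hS⟩
  have key := congrArg (diagonalFunctional (min s r) x)
    (sum_superset_pow_sdiff_eq_sum_powerset hα hS hs hr (C X : ℝ[X][X]) X)
  rw [map_sum, map_sum] at key
  rw [Finset.sum_apply]
  refine Eq.trans ?_ (key.trans (Finset.sum_congr rfl fun J _ => ?_))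
  swap
  · by_cases hJ : J ⊆ S <;> simp [supersetIndicator, hJ]
  rw [Matrix.mulVec, dotProduct]
  have hT : ∀ T : Finset α, diagonalFunctional (min s r) x
      (if U ⊆ T then C X ^ (S \ T).card * X ^ (T \ S).card else 0) =
      if T.card = s then (if U ⊆ T then x (min s r - (S \ T).card) else 0) else 0 := by
    intro T
    have h1 := Finset.card_sdiff_add_card_inter S T
    have h2 := Finset.card_sdiff_add_card_inter T S
    rw [Finset.inter_comm] at h2
    have h3 : (T \ S).card ≤ r := by
      have := Finset.card_le_card (show T \ S ⊆ Sᶜ by intro a; simp)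
      rw [Finset.card_compl] at this
      omega
    by_cases hU : U ⊆ T
    · simp only [hU, if_true, diagonalFunctional_monomial]
      congr 1
      apply propext
      constructor
      · rintro ⟨h, _⟩; omega
      · intro h
        refine ⟨by omega, le_min (by omega) (by omega)⟩
    · simp [hU]
  simp only [hT]
  rw [← Finset.sum_filter]
  rw [← Finset.sum_subtype_of_mem (p := fun T : Finset α => T.card = s)
    (fun T => if U ⊆ T then x (min s r - (S \ T).card) else 0) (by simp)]
  refine Finset.sum_congr (by ext T; simp [T.2]) fun T _ => ?_
  simp [hA, supersetIndicator]

/-- The indicator of a single `s`-element subset of `α` is spanned by the functions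
`supersetIndicator s J` with `#J ≤ min s r`, where `#α = s + r`. -/
lemma single_mem_span_supersetIndicator {α : Type*} [Fintype α] [DecidableEq α] {s r : ℕ}
    (hα : Fintype.card α = s + r) (S : {S : Finset α // S.card = s}) :
    (Pi.single S 1 : {S : Finset α // S.card = s} → ℝ) ∈
      Submodule.span ℝ (supersetIndicator s '' {J : Finset α | J.card < min s r + 1}) := by
  rcases le_total s r with h | h
  · refine Submodule.subset_span ⟨S.val, by simp [S.2, h], ?_⟩
    ext T
    have : S.val ⊆ T.val ↔ T = S := by
      rw [Subtype.ext_iff]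
      exact ⟨fun hST => (Finset.eq_of_subset_of_card_le hST (by simp [S.2, T.2])).symm,
        fun e => e ▸ subset_rfl⟩
    simp [supersetIndicator, this, Pi.single_apply]
  · have e : (Pi.single S 1 : {S : Finset α // S.card = s} → ℝ) =
        ∑ J ∈ (S.val)ᶜ.powerset, (-1 : ℝ) ^ J.card • supersetIndicator s J := by
      ext T
      have h1 : ∏ a ∈ (S.val)ᶜ, ((if a ∈ T.val then (-1 : ℝ) else 0) + 1) =
          if T = S then 1 else 0 := by
        split_ifs with hT
        · subst hT
          exact Finset.prod_eq_one fun a ha => by simp [Finset.mem_compl.1 ha]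
        · have : ¬ T.val ⊆ S.val := fun hTS =>
            hT (Subtype.ext (Finset.eq_of_subset_of_card_le hTS (by simp [S.2, T.2])))
          obtain ⟨a, ha, haS⟩ := Finset.not_subset.1 this
          exact Finset.prod_eq_zero (Finset.mem_compl.2 haS) (by simp [ha])
      rw [Pi.single_apply, ← h1, Finset.prod_add, Finset.sum_apply]
      refine Finset.sum_congr rfl fun J _ => ?_
      rw [Finset.prod_const_one, mul_one]
      by_cases hJ : J ⊆ T.val
      · rw [Finset.prod_congr rfl fun a ha => if_pos (hJ ha)]
        simp [supersetIndicator, hJ]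
      · obtain ⟨a, ha, haT⟩ := Finset.not_subset.1 hJ
        rw [Finset.prod_eq_zero ha (if_neg haT)]
        simp [supersetIndicator, hJ]
    rw [e]
    refine Submodule.sum_mem _ fun J hJ => Submodule.smul_mem _ _
      (Submodule.subset_span ⟨J, ?_, rfl⟩)
    have := Finset.card_le_card (Finset.mem_powerset.1 hJ)
    rw [Finset.card_compl, S.2, hα] at this
    simp only [Set.mem_ofPred_eq]
    omega


/-- The monic polynomial `∏_{l=0}^{min(s,r)} (X - λ_l)` annihilates the symmetric
diagram matrix `A^{s+r,s}`: the matrix product `∏_{l=0}^{min(s,r)} (A - λ_l • 1)` is zero. -/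
theorem stmt_2 (s r : ℕ) (x : ℕ → ℝ)
    (A : Matrix {S : Finset (Fin (s + r)) // S.card = s}
                {S : Finset (Fin (s + r)) // S.card = s} ℝ)
    (hA : ∀ S T, A S T = x (min s r - (S.val \ T.val).card)) :
    ((List.range (min s r + 1)).map (fun l =>
      A - (∑ t ∈ Finset.range (min s r + 1),
        (∑ j ∈ Finset.range (l + 1),
          (-1 : ℝ) ^ j * (l.choose j : ℝ) *
            (if j ≤ t then ((s - l).choose (t - j) * (r - l).choose (t - j) : ℝ) else 0)) *
        x (min s r - t)) •
        (1 : Matrix {S : Finset (Fin (s + r)) // S.card = s}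
                    {S : Finset (Fin (s + r)) // S.card = s} ℝ))).prod = 0 := by
  have hα : Fintype.card (Fin (s + r)) = s + r := Fintype.card_fin _
  set B : ℕ → Matrix {S : Finset (Fin (s + r)) // S.card = s}
      {S : Finset (Fin (s + r)) // S.card = s} ℝ := fun l => A - (∑ t ∈ Finset.range (min s r + 1),
        (∑ j ∈ Finset.range (l + 1),
          (-1 : ℝ) ^ j * (l.choose j : ℝ) *
            (if j ≤ t then ((s - l).choose (t - j) * (r - l).choose (t - j) : ℝ) else 0)) *
        x (min s r - t)) • 1 with hB
  let V : ℕ → Submodule ℝ ({S : Finset (Fin (s + r)) // S.card = s} → ℝ) := fun k =>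
    Submodule.span ℝ (supersetIndicator s '' {J | J.card < k})
  have hstep : ∀ k, k ≤ min s r → ∀ U : Finset (Fin (s + r)), U.card < k + 1 →
      A.mulVec (supersetIndicator s U) - diagonalFunctional (min s r) x
        ((1 + Polynomial.C Polynomial.X) ^ (s - k) * (1 + Polynomial.X) ^ (r - k) *
          (1 - Polynomial.C Polynomial.X * Polynomial.X) ^ k) • supersetIndicator s U ∈ V k := by
    intro k hk U hU
    have hmem : ∀ J : Finset (Fin (s + r)), J.card < k → supersetIndicator s J ∈ V k :=
      fun J hJ => Submodule.subset_span ⟨J, hJ, rfl⟩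
    rw [mulVec_supersetIndicator hα x A hA (by omega) (by omega)]
    rcases Nat.lt_succ_iff_lt_or_eq.1 hU with h | h
    · refine Submodule.sub_mem _ (Submodule.sum_mem _ fun J hJ => Submodule.smul_mem _ _ ?_)
        (Submodule.smul_mem _ _ (hmem U h))
      exact hmem J ((Finset.card_le_card (Finset.mem_powerset.1 hJ)).trans_lt h)
    · rw [← Finset.sum_erase_add _ _ (Finset.mem_powerset_self U)]
      simp only [Finset.sdiff_self, Finset.card_empty, pow_zero, mul_one, h, add_sub_cancel_right]
      refine Submodule.sum_mem _ fun J hJ => Submodule.smul_mem _ _ (hmem J ?_)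
      rw [← h]
      rw [Finset.mem_erase, Finset.mem_powerset] at hJ
      exact Finset.card_lt_card (hJ.2.ssubset_of_ne hJ.1)
  have hBV : ∀ k, k ≤ min s r → ∀ v ∈ V (k + 1), (B k).mulVec v ∈ V k := by
    intro k hk v hv
    suffices V (k + 1) ≤ (V k).comap (B k).mulVecLin from this hv
    refine Submodule.span_le.2 ?_
    rintro _ ⟨U, hU, rfl⟩
    have := hstep k hk U hU
    rw [diagonalFunctional_eigenvalue] at this
    simpa only [hB, SetLike.mem_coe, Submodule.mem_comap, Matrix.mulVecLin_apply,
      Matrix.sub_mulVec, Matrix.smul_mulVec, Matrix.one_mulVec] using this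
  have hprod : ∀ k, k ≤ min s r + 1 → ∀ v ∈ V k, ((List.range k).map B).prod.mulVec v = 0 := by
    intro k
    induction k with
    | zero =>
      intro _ v hv
      have : v = 0 := by simpa [V] using hv
      simp [this]
    | succ k ih =>
      intro hk v hv
      rw [List.range_succ, List.map_append, List.prod_append, List.map_singleton,
        List.prod_singleton, ← Matrix.mulVec_mulVec]
      exact ih (by omega) _ (hBV k (by omega) v hv)
  refine Matrix.ext_of_mulVec_single fun S => ?_
  rw [hprod _ le_rfl _ (single_mem_span_supersetIndicator hα S), Matrix.zero_mulVec]
end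

section
/- For natural numbers s, r, l with l ≤ min(s,r) and an integer t, define c_t^l(s,r) = Σ_{j=0}^{l} (−1)^j C(l,j) C(s−l, t−j) C(r−l, t−j), with the convention that C(n,k) = 0 when k < 0 or k > n (and c_t^l(s,r) = 0 for t < 0 by this convention). Then for all natural numbers s, r and l with l + 1 ≤ min(s,r), and all integers t: c_t^{l+1}(s,r) = c_t^l(s−1, r−1) − c_{t−1}^l(s−1, r−1). -/
/-- Binomial coefficient `C(n,k)` extended by `0` for negative `k` (and `Nat.choose`
already vanishes for `k > n`). -/
def extChoose (n : ℕ) (k : ℤ) : ℤ :=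
  if 0 ≤ k then (n.choose k.toNat : ℤ) else 0

/-- The coefficient `c_t^l(s,r) = ∑_{j=0}^{l} (-1)^j C(l,j) C(s-l,t-j) C(r-l,t-j)`. -/
def cCoef (s r l : ℕ) (t : ℤ) : ℤ :=
  ∑ j ∈ Finset.range (l + 1),
    (-1 : ℤ) ^ j * (l.choose j : ℤ) * extChoose (s - l) (t - j) * extChoose (r - l) (t - j)

/-- Pascal's rule for alternating binomial sums. -/
theorem sum_alternating_choose_succ {R : Type*} [CommRing R] (l : ℕ) (g : ℕ → R) :
    ∑ j ∈ Finset.range (l + 1 + 1), (-1 : R) ^ j * ((l + 1).choose j : R) * g j =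
      ∑ j ∈ Finset.range (l + 1), (-1 : R) ^ j * (l.choose j : R) * g j -
        ∑ j ∈ Finset.range (l + 1), (-1 : R) ^ j * (l.choose j : R) * g (j + 1) := by
  have h : ∑ j ∈ Finset.range (l + 1), (-1 : R) ^ j * (l.choose j : R) * g j =
      ∑ j ∈ Finset.range (l + 1 + 1), (-1 : R) ^ j * (l.choose j : R) * g j := by
    simp [Finset.sum_range_succ _ (l + 1)]
  rw [h, Finset.sum_range_succ', Finset.sum_range_succ' _ (l + 1), add_sub_right_comm,
    ← Finset.sum_sub_distrib]
  congr 1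
  · refine Finset.sum_congr rfl fun j _ => ?_
    rw [Nat.choose_succ_succ]
    push_cast
    ring
  · simp

/-- `c_t^{l+1}(s,r) = c_t^l(s-1,r-1) - c_{t-1}^l(s-1,r-1)` whenever `l + 1 ≤ min s r`. -/
theorem stmt_7 (s r l : ℕ) (hl : l + 1 ≤ min s r) (t : ℤ) :
    cCoef s r (l + 1) t = cCoef (s - 1) (r - 1) l t - cCoef (s - 1) (r - 1) l (t - 1) := by
  have hs : s - (l + 1) = s - 1 - l := by omega
  have hr : r - (l + 1) = r - 1 - l := by omega
  have h := sum_alternating_choose_succ l fun j =>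
    extChoose (s - 1 - l) (t - j) * extChoose (r - 1 - l) (t - j)
  simpa only [cCoef, hs, hr, mul_assoc, Nat.cast_add, Nat.cast_one, sub_sub,
    add_comm (1 : ℤ)] using h
end

section
/- Fix natural numbers s and r and a real number x. Let G(s,r,x) be the real square matrix of size C(s+r,s) indexed by the s-element subsets of {1,…,s+r}, whose entry at a pair (S,T) is (−1)^f · f! · Π_{m=f}^{r−1} (x − (s+m)), where f = |S \ T|. Then the set of real eigenvalues of G(s,r,x) is exactly { Π_{i=0}^{l−1} (x − (s−1+i)) · Π_{j=0}^{r−l−1} (x − (2s+j)) : 0 ≤ l ≤ min(s,r) }; in particular, each eigenvalue of G(s,r,x) is an eigenvalue for some such l, and each such product is attained as an eigenvalue. -/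
open Finset in
/-- The kernel operator on functions of `l`-element sets with kernel `c |S \ T|`. -/
def johnsonOp {α : Type*} [Fintype α] [DecidableEq α] (l : ℕ) (c : ℕ → ℝ)
    (f : Finset α → ℝ) (S : Finset α) : ℝ :=
  ∑ T ∈ powersetCard l univ, c (#(S \ T)) * f T

/-- Sum of `f` over the sets covering `R`. -/
def downOp {α : Type*} [Fintype α] [DecidableEq α] (f : Finset α → ℝ) (R : Finset α) : ℝ :=
  ∑ a ∈ Rᶜ, f (insert a R)

/-- Sum of `f` over the sets covered by `S`. -/
def upOp {α : Type*} [DecidableEq α] (f : Finset α → ℝ) (S : Finset α) : ℝ :=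
  ∑ b ∈ S, f (S.erase b)

/-- The kernel of the Gram block transported to `l`-element sets. -/
noncomputable def gramKernel (s r : ℕ) (y : ℝ) (l g : ℕ) : ℝ :=
  (-1) ^ g * (g.factorial : ℝ) * (∏ m ∈ Finset.Ico g l, (y - m)) *
    ∏ m ∈ Finset.Ico s (s + r - l), (y - m)

/-- The eigenvalue of the Gram block on the component generated by `l`-element sets. -/
noncomputable def gramEigenvalue (s r : ℕ) (x : ℝ) (l : ℕ) : ℝ :=
  (∏ i ∈ Finset.range l, (x - ((s : ℝ) - 1 + (i : ℝ)))) *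
    ∏ j ∈ Finset.range (r - l), (x - (2 * (s : ℝ) + (j : ℝ)))

section SetOperators

open Finset

variable {α : Type*} [DecidableEq α]

theorem sum_card_sdiff_erase (c : ℕ → ℝ) (R T : Finset α) :
    ∑ b ∈ T, c (#(R \ T.erase b)) =
      #T * c (#(R \ T) + 1) + #(T \ R) * (c (#(R \ T)) - c (#(R \ T) + 1)) := by
  have h : ∀ b ∈ T, c (#(R \ T.erase b)) =
      c (#(R \ T) + 1) + if b ∉ R then c (#(R \ T)) - c (#(R \ T) + 1) else 0 := by
    intro b hb
    split_ifs with hbR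
    · have : R \ T.erase b = insert b (R \ T) := by
        ext x
        by_cases hx : x = b
        · subst hx; simpa using hbR
        · simp [hx]
      rw [this, card_insert_of_notMem (by simp [hb])]; ring
    · have : R \ T.erase b = R \ T := by
        ext x
        by_cases hx : x = b
        · subst hx; simp [hbR]
        · simp [hx]
      rw [this]; ring
  rw [sum_congr rfl h, sum_add_distrib, ← sum_filter]
  have : T.filter (· ∉ R) = T \ R := by ext; simp
  rw [this, sum_const, sum_const, nsmul_eq_mul, nsmul_eq_mul]

theorem sum_card_erase_sdiff (e : ℕ → ℝ) (S T : Finset α) :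
    ∑ b ∈ T, e (#(T.erase b \ S)) =
      #T * e (#(T \ S)) + #(T \ S) * (e (#(T \ S) - 1) - e (#(T \ S))) := by
  have h : ∀ b ∈ T, e (#(T.erase b \ S)) =
      e (#(T \ S)) + if b ∉ S then e (#(T \ S) - 1) - e (#(T \ S)) else 0 := by
    intro b hb
    rw [erase_sdiff_comm]
    split_ifs with hbS
    · rw [erase_eq_of_notMem (by simp [hbS])]; ring
    · rw [card_erase_of_mem (by simp [hb, hbS])]; ring
  rw [sum_congr rfl h, sum_add_distrib, ← sum_filter]
  have : T.filter (· ∉ S) = T \ S := by ext; simp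
  rw [this, sum_const, sum_const, nsmul_eq_mul, nsmul_eq_mul]

variable [Fintype α]

theorem sum_insert_eq_sum_erase (j : ℕ) (F : Finset α → Finset α → ℝ) :
    ∑ R ∈ powersetCard j univ, ∑ a ∈ Rᶜ, F R (insert a R) =
      ∑ T ∈ powersetCard (j + 1) univ, ∑ b ∈ T, F (T.erase b) T := by
  rw [Finset.sum_sigma', Finset.sum_sigma']
  refine Finset.sum_bij' (fun p _ => ⟨insert p.2 p.1, p.2⟩) (fun p _ => ⟨p.1.erase p.2, p.2⟩)
    ?_ ?_ ?_ ?_ ?_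
  · rintro ⟨R, a⟩ h
    simp only [mem_sigma, mem_powersetCard_univ, mem_compl] at h ⊢
    exact ⟨by rw [card_insert_of_notMem h.2, h.1], mem_insert_self _ _⟩
  · rintro ⟨T, b⟩ h
    simp only [mem_sigma, mem_powersetCard_univ, mem_compl] at h ⊢
    exact ⟨by rw [card_erase_of_mem h.2, h.1]; rfl, notMem_erase _ _⟩
  · rintro ⟨R, a⟩ h
    simp only [mem_sigma, mem_powersetCard_univ, mem_compl] at h
    simp [erase_insert h.2]
  · rintro ⟨T, b⟩ h
    simp only [mem_sigma, mem_powersetCard_univ] at h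
    simp [insert_erase h.2]
  · rintro ⟨R, a⟩ h
    simp only [mem_sigma, mem_powersetCard_univ, mem_compl] at h
    simp [erase_insert h.2]

theorem sum_card_insert_sdiff (c : ℕ → ℝ) (R T : Finset α) :
    ∑ a ∈ Rᶜ, c (#(insert a R \ T)) =
      #Rᶜ * c (#(R \ T) + 1) + #(T \ R) * (c (#(R \ T)) - c (#(R \ T) + 1)) := by
  have h : ∀ a ∈ Rᶜ, c (#(insert a R \ T)) =
      c (#(R \ T) + 1) + if a ∈ T then c (#(R \ T)) - c (#(R \ T) + 1) else 0 := by
    intro a ha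
    split_ifs with haT
    · rw [insert_sdiff_of_mem _ haT]; ring
    · rw [insert_sdiff_of_notMem _ haT, card_insert_of_notMem]
      · ring
      · simp only [mem_compl] at ha; simp [ha]
  rw [sum_congr rfl h, sum_add_distrib, ← sum_filter]
  have : Rᶜ.filter (· ∈ T) = T \ R := by ext; simp [and_comm]
  rw [this, sum_const, sum_const, nsmul_eq_mul, nsmul_eq_mul]

/-- The relation between kernels on `j + 1`-element and `j`-element sets under which the kernel
operators are intertwined by `downOp` and `upOp`. -/
def KernelsIntertwine (n j : ℕ) (c c' : ℕ → ℝ) : Prop :=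
  ∀ g ≤ j, ((n : ℝ) - j) * c (g + 1) + (g + 1) * (c g - c (g + 1)) =
    (j + 1) * c' (g + 1) + (g + 1) * (c' g - c' (g + 1))

theorem KernelsIntertwine.sum_eq {j : ℕ} {c c' : ℕ → ℝ}
    (h : KernelsIntertwine (Fintype.card α) j c c') {R T : Finset α}
    (hR : #R = j) (hT : #T = j + 1) :
    ∑ a ∈ Rᶜ, c (#(insert a R \ T)) = ∑ b ∈ T, c' (#(R \ T.erase b)) := by
  rw [sum_card_insert_sdiff, sum_card_sdiff_erase]
  have h1 : #(T \ R) = #(R \ T) + 1 := by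
    have := card_sdiff_add_card_inter T R
    have := card_sdiff_add_card_inter R T
    rw [inter_comm] at this
    omega
  have h2 : #(R \ T) ≤ j := hR ▸ card_le_card sdiff_subset
  have := h _ h2
  rw [h1, hT, card_compl, hR, Nat.cast_sub (hR ▸ card_le_univ R)]
  push_cast
  exact this

theorem downOp_johnsonOp {j : ℕ} {c c' : ℕ → ℝ}
    (h : KernelsIntertwine (Fintype.card α) j c c') (f : Finset α → ℝ) {R : Finset α}
    (hR : #R = j) :
    downOp (johnsonOp (j + 1) c f) R = johnsonOp j c' (downOp f) R := by
  unfold downOp johnsonOp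
  simp_rw [mul_sum]
  rw [sum_insert_eq_sum_erase j (fun R' T => c' (#(R \ R')) * f T), sum_comm]
  refine sum_congr rfl fun T hT => ?_
  rw [← sum_mul, ← sum_mul, h.sum_eq hR (mem_powersetCard_univ.1 hT)]

theorem johnsonOp_upOp {j : ℕ} {c c' : ℕ → ℝ}
    (h : KernelsIntertwine (Fintype.card α) j c c') (f : Finset α → ℝ) {S : Finset α}
    (hS : #S = j + 1) :
    johnsonOp (j + 1) c (upOp f) S = upOp (johnsonOp j c' f) S := by
  unfold upOp johnsonOp
  simp_rw [mul_sum]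
  rw [← sum_insert_eq_sum_erase j (fun R T => c (#(S \ T)) * f R), sum_comm]
  refine sum_congr rfl fun R hR => ?_
  have hR' := mem_powersetCard_univ.1 hR
  rw [← sum_mul, ← sum_mul]
  congr 1
  trans ∑ a ∈ Rᶜ, c (#(insert a R \ S))
  · refine sum_congr rfl fun a ha => ?_
    rw [card_sdiff_comm]
    rw [card_insert_of_notMem (mem_compl.1 ha), hS, hR']
  · rw [h.sum_eq hR' hS]
    refine sum_congr rfl fun b hb => ?_
    rw [card_sdiff_comm]
    rw [card_erase_of_mem hb, hS, hR']; rfl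

theorem johnsonOp_of_downOp_eq_zero {j : ℕ} {c e : ℕ → ℝ} {μ : ℝ}
    (h : ∀ g ≤ j + 1, c g = (if g = 0 then μ else 0) +
      (((j : ℝ) + 1) * e g + g * (e (g - 1) - e g)))
    {f : Finset α → ℝ} (hf : ∀ R : Finset α, #R = j → downOp f R = 0) {S : Finset α}
    (hS : #S = j + 1) : johnsonOp (j + 1) c f S = μ * f S := by
  have h0 : ∑ R ∈ powersetCard j univ, e (#(R \ S)) * downOp f R = 0 :=
    sum_eq_zero fun R hR => by rw [hf R (mem_powersetCard_univ.1 hR), mul_zero]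
  unfold downOp at h0
  simp_rw [mul_sum] at h0
  rw [sum_insert_eq_sum_erase j (fun R T => e (#(R \ S)) * f T)] at h0
  have key : ∀ T ∈ powersetCard (j + 1) (univ : Finset α), c (#(S \ T)) * f T =
      (if S = T then μ * f T else 0) + ∑ b ∈ T, e (#(T.erase b \ S)) * f T := by
    intro T hT
    have hT' := mem_powersetCard_univ.1 hT
    have hST : #(S \ T) = #(T \ S) := card_sdiff_comm (hS.trans hT'.symm)
    have hz : #(T \ S) = 0 ↔ S = T := by
      rw [← hST, card_eq_zero, sdiff_eq_empty_iff_subset]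
      exact ⟨fun hs => eq_of_subset_of_card_le hs (by omega), fun hs => hs ▸ Subset.rfl⟩
    rw [← sum_mul, sum_card_erase_sdiff, hST, h _ (hT' ▸ card_le_card sdiff_subset), hT']
    simp only [hz]
    split_ifs <;> push_cast <;> ring
  unfold johnsonOp
  rw [sum_congr rfl key, sum_add_distrib, h0, add_zero, sum_ite_eq]
  simp [hS]

theorem downOp_upOp (f : Finset α → ℝ) (R : Finset α) :
    downOp (upOp f) R = upOp (downOp f) R + ((Fintype.card α : ℝ) - 2 * #R) * f R := by
  have h1 : ∀ a ∈ Rᶜ, upOp f (insert a R) = f R + ∑ b ∈ R, f (insert a (R.erase b)) := by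
    intro a ha
    have ha' := mem_compl.1 ha
    unfold upOp
    rw [sum_insert ha', erase_insert ha']
    congr 1
    refine sum_congr rfl fun b hb => ?_
    rw [erase_insert_of_ne (by rintro rfl; exact ha' hb)]
  have h2 : ∀ b ∈ R, downOp f (R.erase b) = f R + ∑ a ∈ Rᶜ, f (insert a (R.erase b)) := by
    intro b hb
    unfold downOp
    rw [compl_erase, sum_insert (by simpa using hb), insert_erase hb]
  have e1 : downOp (upOp f) R = ∑ a ∈ Rᶜ, (f R + ∑ b ∈ R, f (insert a (R.erase b))) :=
    sum_congr rfl h1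
  have e2 : upOp (downOp f) R = ∑ b ∈ R, (f R + ∑ a ∈ Rᶜ, f (insert a (R.erase b))) :=
    sum_congr rfl h2
  rw [e1, e2, sum_add_distrib, sum_add_distrib, sum_comm]
  simp only [sum_const, nsmul_eq_mul, card_compl, Nat.cast_sub (card_le_univ R)]
  ring

theorem sum_downOp_mul (j : ℕ) (f g : Finset α → ℝ) :
    ∑ R ∈ powersetCard j univ, downOp f R * g R =
      ∑ T ∈ powersetCard (j + 1) univ, f T * upOp g T := by
  unfold downOp upOp
  simp_rw [mul_sum, sum_mul]
  exact sum_insert_eq_sum_erase j (fun R T => f T * g R)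

theorem exists_upOp_ne_zero {j : ℕ} (hj : 2 * j < Fintype.card α) {f : Finset α → ℝ}
    (hf : ∃ R : Finset α, #R = j ∧ f R ≠ 0) :
    ∃ S : Finset α, #S = j + 1 ∧ upOp f S ≠ 0 := by
  by_contra! hU
  obtain ⟨R₀, hR₀, hne⟩ := hf
  have hj' : (0 : ℝ) < (Fintype.card α : ℝ) - 2 * j := by
    have : (2 * j : ℝ) < Fintype.card α := by exact_mod_cast hj
    linarith
  have h1 : ∑ R ∈ powersetCard j univ, downOp (upOp f) R * f R = 0 := by
    rw [sum_downOp_mul]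
    exact sum_eq_zero fun T hT => by rw [hU T (mem_powersetCard_univ.1 hT), mul_zero]
  have h2 : 0 ≤ ∑ R ∈ powersetCard j (univ : Finset α), upOp (downOp f) R * f R := by
    cases j with
    | zero => simp [upOp]
    | succ i =>
      have := sum_downOp_mul i f (downOp f)
      simp_rw [mul_comm (upOp _ _)]
      rw [← this]
      exact sum_nonneg fun R _ => mul_self_nonneg _
  have h3 : ∑ R ∈ powersetCard j univ, downOp (upOp f) R * f R =
      ∑ R ∈ powersetCard j (univ : Finset α), upOp (downOp f) R * f R +
        ((Fintype.card α : ℝ) - 2 * j) * ∑ R ∈ powersetCard j (univ : Finset α), f R * f R := by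
    rw [mul_sum, ← sum_add_distrib]
    refine sum_congr rfl fun R hR => ?_
    rw [downOp_upOp, mem_powersetCard_univ.1 hR]
    ring
  have h4 : 0 < ∑ R ∈ powersetCard j (univ : Finset α), f R * f R :=
    sum_pos' (fun R _ => mul_self_nonneg _)
      ⟨R₀, mem_powersetCard_univ.2 hR₀, mul_self_pos.2 hne⟩
  have := mul_pos hj' h4
  linarith

theorem exists_downOp_eq_zero {j : ℕ} (hj : 2 * (j + 1) ≤ Fintype.card α) :
    ∃ f : Finset α → ℝ, (∃ S : Finset α, #S = j + 1 ∧ f S ≠ 0) ∧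
      ∀ R : Finset α, #R = j → downOp f R = 0 := by
  let D : (Finset α → ℝ) →ₗ[ℝ] (Finset α → ℝ) :=
    { toFun := downOp
      map_add' := fun f g => by ext; simp [downOp, sum_add_distrib]
      map_smul' := fun a f => by ext; simp [downOp, mul_sum] }
  let L : ({S : Finset α // #S = j + 1} → ℝ) →ₗ[ℝ] ({R : Finset α // #R = j} → ℝ) :=
    LinearMap.funLeft ℝ ℝ Subtype.val ∘ₗ D ∘ₗ
      Function.ExtendByZero.linearMap ℝ Subtype.val
  have hL : LinearMap.ker L ≠ ⊥ := by
    apply LinearMap.ker_ne_bot_of_finrank_lt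
    rw [Module.finrank_fintype_fun_eq_card, Module.finrank_fintype_fun_eq_card,
      Fintype.card_finset_len, Fintype.card_finset_len]
    have hpos : 0 < (Fintype.card α).choose j := Nat.choose_pos (by omega)
    have hlt : j + 1 < Fintype.card α - j := by omega
    refine lt_of_mul_lt_mul_right ?_ (Nat.zero_le (j + 1))
    rw [Nat.choose_succ_right_eq]
    exact Nat.mul_lt_mul_of_pos_left hlt hpos
  obtain ⟨v, hv, hv0⟩ := (Submodule.ne_bot_iff _).1 hL
  obtain ⟨S, hS⟩ := Function.ne_iff.1 hv0
  refine ⟨Function.ExtendByZero.linearMap ℝ Subtype.val v, ⟨S, S.2, ?_⟩, fun R hR => ?_⟩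
  · rwa [Function.ExtendByZero.linearMap_apply, Subtype.val_injective.extend_apply]
  · exact congrFun (LinearMap.mem_ker.1 hv) ⟨R, hR⟩

end SetOperators

section GramKernel

open Finset

theorem gramKernel_intertwine {s r j : ℕ} (y : ℝ) (hj : j + 1 ≤ r) :
    KernelsIntertwine (s + r) j (gramKernel s r y (j + 1)) (gramKernel s r y j) := by
  intro g hg
  have hP : ∏ m ∈ Ico s (s + r - j), (y - m) =
      (∏ m ∈ Ico s (s + r - (j + 1)), (y - m)) * (y - (s + r - j - 1)) := by
    have h1 : s + r - j = s + r - (j + 1) + 1 := by omega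
    rw [h1, prod_Ico_succ_top (by omega), Nat.cast_sub (by omega)]
    push_cast
    ring
  have hA : ∏ m ∈ Ico g (j + 1), (y - m) = (y - g) * ∏ m ∈ Ico (g + 1) (j + 1), (y - m) :=
    prod_eq_prod_Ico_succ_bot (by omega) _
  simp only [gramKernel, hP, hA, Nat.factorial_succ, pow_succ]
  push_cast
  rcases hg.lt_or_eq with hlt | rfl
  · have hB : ∏ m ∈ Ico g j, (y - m) = (y - g) * ∏ m ∈ Ico (g + 1) j, (y - m) :=
      prod_eq_prod_Ico_succ_bot hlt _
    have hC : ∏ m ∈ Ico (g + 1) (j + 1), (y - m) =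
        (∏ m ∈ Ico (g + 1) j, (y - m)) * (y - j) := prod_Ico_succ_top (by omega) _
    rw [hB, hC]
    ring
  · simp only [Ico_self, prod_empty]
    ring

theorem gramEigenvalue_eq {s r l : ℕ} (x : ℝ) (hl : l ≤ r) :
    gramEigenvalue s r x l = (∏ i ∈ range l, (x - s + 1 - i)) *
      ∏ m ∈ Ico s (s + r - l), (x - s - m) := by
  unfold gramEigenvalue
  congr 1
  · exact prod_congr rfl fun i _ => by ring
  · rw [prod_Ico_eq_prod_range, show s + r - l - s = r - l by omega]
    exact prod_congr rfl fun i _ => by push_cast; ring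

theorem gramKernel_zero (s r : ℕ) (x : ℝ) :
    gramKernel s r (x - s) 0 0 = gramEigenvalue s r x 0 := by
  rw [gramEigenvalue_eq x (Nat.zero_le r)]
  simp [gramKernel]

theorem gramKernel_harmonic {s r j : ℕ} (x : ℝ) (hj : j + 1 ≤ r) :
    ∃ e : ℕ → ℝ, ∀ g ≤ j + 1, gramKernel s r (x - s) (j + 1) g =
      (if g = 0 then gramEigenvalue s r x (j + 1) else 0) +
        (((j : ℝ) + 1) * e g + g * (e (g - 1) - e g)) := by
  refine ⟨fun g => -((-1) ^ g * (g.factorial : ℝ) * (∏ m ∈ Ico g j, (x - s - m)) *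
    ∏ m ∈ Ico s (s + r - (j + 1)), (x - s - m)), fun g hg => ?_⟩
  rw [gramEigenvalue_eq x hj]
  unfold gramKernel
  cases g with
  | zero =>
    have h1 : ∏ i ∈ range (j + 1), (x - s + 1 - i) =
        (∏ m ∈ Ico 0 j, (x - s - m)) * (x - s + 1) := by
      rw [prod_range_succ', ← range_eq_Ico]
      congr 1
      · exact prod_congr rfl fun i _ => by push_cast; ring
      · simp
    rw [h1, prod_Ico_succ_top (Nat.zero_le j)]
    simp only [if_true, pow_zero, Nat.factorial_zero, Nat.cast_zero, Nat.cast_one]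
    ring
  | succ i =>
    simp only [Nat.succ_ne_zero, if_false, Nat.add_sub_cancel, Nat.factorial_succ, pow_succ]
    push_cast
    rcases (Nat.le_of_succ_le_succ hg).lt_or_eq with hlt | rfl
    · have hB : ∏ m ∈ Ico i j, (x - s - m) = (x - s - i) * ∏ m ∈ Ico (i + 1) j, (x - s - m) :=
        prod_eq_prod_Ico_succ_bot hlt _
      rw [hB, prod_Ico_succ_top (by omega)]
      ring
    · simp only [Ico_self, prod_empty]
      ring

variable (α : Type*) [Fintype α] [DecidableEq α]

/-- `μ` is an eigenvalue of the kernel operator on functions of `l`-element subsets of `α`. -/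
def IsJohnsonEigenvalue (l : ℕ) (c : ℕ → ℝ) (μ : ℝ) : Prop :=
  ∃ f : Finset α → ℝ, (∃ S : Finset α, #S = l ∧ f S ≠ 0) ∧
    ∀ S : Finset α, #S = l → johnsonOp l c f S = μ * f S

variable {α}

theorem johnsonOp_zero (c : ℕ → ℝ) (f : Finset α → ℝ) :
    johnsonOp 0 c f ∅ = c 0 * f ∅ := by
  simp [johnsonOp]

theorem IsJohnsonEigenvalue.exists_eq_gramEigenvalue {s r : ℕ} {x : ℝ}
    (hα : Fintype.card α = s + r) {l : ℕ} (hl : l ≤ r) {μ : ℝ}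
    (h : IsJohnsonEigenvalue α l (gramKernel s r (x - s) l) μ) :
    ∃ k ≤ l, μ = gramEigenvalue s r x k := by
  induction l with
  | zero =>
    obtain ⟨f, ⟨S, hS, hne⟩, hf⟩ := h
    obtain rfl := card_eq_zero.1 hS
    have := hf ∅ rfl
    rw [johnsonOp_zero, gramKernel_zero] at this
    exact ⟨0, le_rfl, (mul_right_cancel₀ hne this).symm⟩
  | succ j ih =>
    obtain ⟨f, ⟨S, hS, hne⟩, hf⟩ := h
    by_cases hD : ∀ R : Finset α, #R = j → downOp f R = 0
    · obtain ⟨e, he⟩ := gramKernel_harmonic (s := s) x hl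
      have := johnsonOp_of_downOp_eq_zero he hD hS
      rw [hf S hS] at this
      exact ⟨j + 1, le_rfl, mul_right_cancel₀ hne this⟩
    · push Not at hD
      obtain ⟨k, hk, hμ⟩ := ih (by omega) ⟨downOp f, hD, fun R hR => by
        rw [← downOp_johnsonOp (hα ▸ gramKernel_intertwine (x - s) hl) f hR]
        unfold downOp
        rw [mul_sum]
        refine sum_congr rfl fun a ha => hf _ ?_
        rw [card_insert_of_notMem (mem_compl.1 ha), hR]⟩
      exact ⟨k, by omega, hμ⟩

theorem isJohnsonEigenvalue_gramEigenvalue_self {s r : ℕ} (x : ℝ)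
    (hα : Fintype.card α = s + r) {l : ℕ} (hs : l ≤ s) (hr : l ≤ r) :
    IsJohnsonEigenvalue α l (gramKernel s r (x - s) l) (gramEigenvalue s r x l) := by
  cases l with
  | zero =>
    refine ⟨fun _ => 1, ⟨∅, rfl, one_ne_zero⟩, fun S hS => ?_⟩
    obtain rfl := card_eq_zero.1 hS
    rw [johnsonOp_zero, gramKernel_zero]
  | succ j =>
    obtain ⟨f, hne, hf⟩ := exists_downOp_eq_zero (α := α) (j := j) (by omega)
    obtain ⟨e, he⟩ := gramKernel_harmonic (s := s) x hr
    exact ⟨f, hne, fun S hS => johnsonOp_of_downOp_eq_zero he hf hS⟩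

theorem isJohnsonEigenvalue_gramEigenvalue {s r : ℕ} (x : ℝ)
    (hα : Fintype.card α = s + r) {l k : ℕ} (hlk : l ≤ k) (hs : k ≤ s) (hr : k ≤ r) :
    IsJohnsonEigenvalue α k (gramKernel s r (x - s) k) (gramEigenvalue s r x l) := by
  induction k, hlk using Nat.le_induction with
  | base => exact isJohnsonEigenvalue_gramEigenvalue_self x hα hs hr
  | succ j hj ih =>
    obtain ⟨f, hne, hf⟩ := ih (by omega) (by omega)
    refine ⟨upOp f, exists_upOp_ne_zero (by omega) hne, fun S hS => ?_⟩
    rw [johnsonOp_upOp (hα ▸ gramKernel_intertwine (x - s) hr) f hS]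
    unfold upOp
    rw [mul_sum]
    refine sum_congr rfl fun b hb => hf _ ?_
    rw [card_erase_of_mem hb, hS]
    rfl

theorem exists_mulVec_eq_smul_iff {ι : Type*} [Fintype ι] {k : ℕ} {c : ℕ → ℝ}
    (φ : ι ≃ {S : Finset α // #S = k}) {G : Matrix ι ι ℝ}
    (hG : ∀ i j, G i j = c (#((φ i).val \ (φ j).val))) (μ : ℝ) :
    (∃ v : ι → ℝ, v ≠ 0 ∧ G.mulVec v = μ • v) ↔ IsJohnsonEigenvalue α k c μ := by
  have key (f : Finset α → ℝ) (i : ι) :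
      G.mulVec (fun i => f (φ i)) i = johnsonOp k c f (φ i) := by
    unfold johnsonOp Matrix.mulVec dotProduct
    simp_rw [hG]
    rw [φ.sum_comp (fun T => c (#((φ i).val \ T.val)) * f T.val)]
    exact (sum_subtype _ (fun _ => mem_powersetCard_univ)
      fun T => c (#((φ i).val \ T)) * f T).symm
  constructor
  · rintro ⟨v, hv0, hv⟩
    let f : Finset α → ℝ := fun S => if h : #S = k then v (φ.symm ⟨S, h⟩) else 0
    have hf : (fun i => f (φ i)) = v := by
      ext i
      simp [f, (φ i).2]
    obtain ⟨i, hi⟩ := Function.ne_iff.1 hv0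
    refine ⟨f, ⟨φ i, (φ i).2, ?_⟩, fun S hS => ?_⟩
    · rw [← hf] at hi
      exact hi
    · have := congrFun hv (φ.symm ⟨S, hS⟩)
      rw [← hf, key] at this
      simpa using this
  · rintro ⟨f, ⟨S, hS, hne⟩, hf⟩
    refine ⟨fun i => f (φ i), fun h => hne ?_, ?_⟩
    · simpa using congrFun h (φ.symm ⟨S, hS⟩)
    · ext i
      rw [key, hf _ (φ i).2]
      rfl

/-- Complementation as a bijection between `s`-element and `r`-element subsets. -/
def complCardEquiv {s r : ℕ} (hα : Fintype.card α = s + r) :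
    {S : Finset α // #S = s} ≃ {S : Finset α // #S = r} where
  toFun S := ⟨S.valᶜ, by rw [card_compl, S.2, hα]; omega⟩
  invFun S := ⟨S.valᶜ, by rw [card_compl, S.2, hα]; omega⟩
  left_inv S := by simp
  right_inv S := by simp

end GramKernel

/-- The set of real eigenvalues of the reduced Gram-matrix block `G(s,r,x)` of the
partition algebra is exactly
`{ ∏_{i=0}^{l-1} (x-(s-1+i)) · ∏_{j=0}^{r-l-1} (x-(2s+j)) : 0 ≤ l ≤ min(s,r) }`. -/
theorem stmt_12 (s r : ℕ) (x : ℝ)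
    (G : Matrix {S : Finset (Fin (s + r)) // S.card = s}
                {S : Finset (Fin (s + r)) // S.card = s} ℝ)
    (hG : ∀ S T, G S T =
      (-1 : ℝ) ^ ((S.val \ T.val).card) * (((S.val \ T.val).card).factorial : ℝ) *
        ∏ m ∈ Finset.Ico ((S.val \ T.val).card) r, (x - ((s : ℝ) + (m : ℝ)))) :
    ∀ μ : ℝ,
      (∃ v : {S : Finset (Fin (s + r)) // S.card = s} → ℝ,
        v ≠ 0 ∧ G.mulVec v = μ • v) ↔
      ∃ l ≤ min s r, μ =
        (∏ i ∈ Finset.range l, (x - ((s : ℝ) - 1 + (i : ℝ)))) *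
          ∏ j ∈ Finset.range (r - l), (x - (2 * (s : ℝ) + (j : ℝ))) := by
  have hα : Fintype.card (Fin (s + r)) = s + r := Fintype.card_fin _
  have hle (S : {S : Finset (Fin (s + r)) // S.card = s}) (T : Finset (Fin (s + r))) :
      (S.val \ T).card ≤ s :=
    (Finset.card_le_card Finset.sdiff_subset).trans S.2.le
  have main : ∀ μ : ℝ, (∃ v : {S : Finset (Fin (s + r)) // S.card = s} → ℝ,
      v ≠ 0 ∧ G.mulVec v = μ • v) ↔ IsJohnsonEigenvalue (Fin (s + r)) (min s r)
        (gramKernel s r (x - s) (min s r)) μ := by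
    rcases le_total s r with h | h
    · rw [min_eq_left h]
      refine exists_mulVec_eq_smul_iff (Equiv.refl _) fun S T => ?_
      rw [Equiv.refl_apply, Equiv.refl_apply, hG, gramKernel, mul_assoc _ (∏ m ∈ _, _),
        Nat.add_sub_cancel_left,
        Finset.prod_Ico_consecutive _ (hle S T.val) h]
      simp only [sub_sub]
    · rw [min_eq_right h]
      refine exists_mulVec_eq_smul_iff (complCardEquiv hα) fun S T => ?_
      have hc : (S.valᶜ \ T.valᶜ).card = (S.val \ T.val).card := by
        rw [compl_sdiff_compl, Finset.card_sdiff_comm (T.2.trans S.2.symm)]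
      simp only [complCardEquiv, Equiv.coe_fn_mk]
      rw [hG, hc, gramKernel, Nat.add_sub_cancel, Finset.Ico_self, Finset.prod_empty, mul_one]
      simp only [sub_sub]
  intro μ
  rw [main]
  constructor
  · exact fun h => h.exists_eq_gramEigenvalue hα (min_le_right s r)
  · rintro ⟨l, hl, rfl⟩
    exact isJohnsonEigenvalue_gramEigenvalue x hα hl (min_le_left s r) (min_le_right s r)
end

section
/- Let s and r be natural numbers, let 0 ≤ l ≤ min(s,r), and let x be any real number. Then Σ_{t=0}^{min(s,r)} [ Σ_{j=0}^{l} (−1)^j C(l,j) C(s−l, t−j) C(r−l, t−j) ] · (−1)^t · t! · Π_{m=t}^{r−1} (x − (s+m)) = Π_{i=0}^{l−1} (x − (s−1+i)) · Π_{j=0}^{r−l−1} (x − (2s+j)). In particular, each eigenvalue of the Gram-matrix block of the partition algebra is a product of linear factors with integer roots: l factors with roots s−1, s, …, s+l−2 and r−l factors with roots 2s, 2s+1, …, 2s+r−l−1. -/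
/-- The Chu–Vandermonde identity, with rising factorials of `p` and falling products of `z`. -/
theorem sum_choose_mul_prod_mul_prod_Ico {R : Type*} [CommRing R] (n : ℕ) (z p : R) :
    ∑ k ∈ Finset.range (n + 1), (n.choose k : R) *
        ((∏ i ∈ Finset.range k, (p + i)) * ∏ m ∈ Finset.Ico k n, (z - m)) =
      ∏ i ∈ Finset.range n, (z + p - i) := by
  induction n generalizing z p with
  | zero => simp
  | succ n ih =>
    have h₁ : ∑ k ∈ Finset.range (n + 2), (n.choose k : R) *
        ((∏ i ∈ Finset.range k, (p + i)) * ∏ m ∈ Finset.Ico k (n + 1), (z - m)) =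
        (z - n) * ∏ i ∈ Finset.range n, (z + p - i) := by
      rw [Finset.sum_range_succ, Nat.choose_succ_self, Nat.cast_zero, zero_mul, add_zero,
        ← ih, Finset.mul_sum]
      refine Finset.sum_congr rfl fun k hk => ?_
      rw [Finset.prod_Ico_succ_top (by simpa [Nat.lt_succ_iff] using hk)]
      ring
    have h₂ : ∑ k ∈ Finset.range (n + 1), (n.choose k : R) *
        ((∏ i ∈ Finset.range (k + 1), (p + i)) *
          ∏ m ∈ Finset.Ico (k + 1) (n + 1), (z - m)) =
        p * ∏ i ∈ Finset.range n, (z + p - i) := by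
      have h := ih (z - 1) (p + 1)
      rw [show z - 1 + (p + 1) = z + p by ring] at h
      rw [← h, Finset.mul_sum]
      refine Finset.sum_congr rfl fun k _ => ?_
      rw [Finset.prod_range_succ', ← Finset.prod_Ico_add' (fun m : ℕ => z - (m : R)) k n 1]
      simp only [Nat.cast_add, Nat.cast_one, Nat.cast_zero, add_zero, sub_sub, add_assoc,
        add_comm (1 : R)]
      ring
    rw [Finset.sum_range_succ'] at h₁ ⊢
    simp only [Nat.choose_succ_succ', Nat.cast_add, add_mul, Finset.sum_add_distrib] at h₁ ⊢
    rw [Finset.prod_range_succ, h₂]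
    simp only [Nat.choose_zero_right] at h₁ ⊢
    linear_combination h₁

/-- A shifted sum against a function vanishing beyond `N` does not depend on its length. -/
theorem sum_range_ite_le_mul_eq {R : Type*} [CommRing R] {g : ℕ → R} {N : ℕ}
    (hg : ∀ k, N < k → g k = 0) (h : ℕ → R) {M K j : ℕ} (hM : N + j < M) (hK : N < K) :
    ∑ t ∈ Finset.range M, (if j ≤ t then g (t - j) else 0) * h t =
      ∑ k ∈ Finset.range K, g k * h (j + k) := by
  obtain ⟨L, rfl⟩ : ∃ L, M = j + L := ⟨M - j, by omega⟩
  rw [Finset.sum_range_add, Finset.sum_eq_zero, zero_add]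
  · simp only [Nat.le_add_right, if_true, Nat.add_sub_cancel_left]
    have key (K' : ℕ) (hK' : N < K') : ∑ k ∈ Finset.range (N + 1), g k * h (j + k) =
        ∑ k ∈ Finset.range K', g k * h (j + k) :=
      Finset.sum_subset (Finset.range_subset_range.2 hK') fun k _ hk => by
        rw [hg k (by simpa using hk), zero_mul]
    rw [← key L (by omega), ← key K hK]
  · intro t ht
    rw [if_neg (by simpa using ht), zero_mul]

theorem prod_range_neg_natCast_add {R : Type*} [CommRing R] (a k : ℕ) :
    ∏ i ∈ Finset.range k, (-(a : R) + i) = (-1) ^ k * (k.factorial * a.choose k) := by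
  rw [← Nat.cast_mul, ← Nat.descFactorial_eq_factorial_mul_choose]
  induction k with
  | zero => simp
  | succ k ih =>
    rw [Finset.prod_range_succ, ih, Nat.descFactorial_succ]
    rcases le_or_gt k a with h | h
    · push_cast [h]
      ring
    · simp [Nat.descFactorial_eq_zero_iff_lt.2 h]

theorem factorial_mul_prod_range_natCast_add {R : Type*} [CommRing R] (k j : ℕ) :
    (k.factorial : R) * ∏ i ∈ Finset.range j, ((k : R) + 1 + i) = ((j + k).factorial : R) := by
  rw [add_comm j, ← Nat.factorial_mul_ascFactorial, Nat.ascFactorial_eq_prod_range]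
  push_cast
  rfl


/-- The eigenvalue `λ_l` of the Gram-matrix block of the partition algebra factors into
linear polynomials with integer roots:
`∑_t [∑_j (-1)^j C(l,j) C(s-l,t-j) C(r-l,t-j)] (-1)^t t! ∏_{m=t}^{r-1}(x-(s+m))
  = ∏_{i=0}^{l-1}(x-(s-1+i)) · ∏_{j=0}^{r-l-1}(x-(2s+j))`. -/
theorem stmt_13 (s r l : ℕ) (hl : l ≤ min s r) (x : ℝ) :
    ∑ t ∈ Finset.range (min s r + 1),
      (∑ j ∈ Finset.range (l + 1),
        (-1 : ℝ) ^ j * (l.choose j : ℝ) *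
          (if j ≤ t then ((s - l).choose (t - j) * (r - l).choose (t - j) : ℝ) else 0)) *
      ((-1 : ℝ) ^ t * (t.factorial : ℝ) *
        ∏ m ∈ Finset.Ico t r, (x - ((s : ℝ) + (m : ℝ))))
    = (∏ i ∈ Finset.range l, (x - ((s : ℝ) - 1 + (i : ℝ)))) *
        ∏ j ∈ Finset.range (r - l), (x - (2 * (s : ℝ) + (j : ℝ))) := by
  obtain ⟨a, rfl⟩ := Nat.exists_eq_add_of_le (hl.trans (min_le_left s r))
  obtain ⟨b, rfl⟩ := Nat.exists_eq_add_of_le (hl.trans (min_le_right (l + a) r))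
  simp only [Nat.add_sub_cancel_left]
  set y : ℝ := x - (l + a : ℕ) with hy
  have inner (k : ℕ) (hk : k ≤ b) :
      ∑ j ∈ Finset.range (l + 1), (l.choose j : ℝ) *
        (((j + k).factorial : ℝ) * ∏ m ∈ Finset.Ico (j + k) (l + b), (y - m)) =
      (k.factorial * ∏ m ∈ Finset.Ico k b, (y - l - m)) * ∏ i ∈ Finset.range l, (y + 1 - i) := by
    have h := sum_choose_mul_prod_mul_prod_Ico l (y - k) ((k : ℝ) + 1)
    rw [show y - k + (k + 1) = y + 1 by ring] at h
    rw [← h, Finset.mul_sum]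
    refine Finset.sum_congr rfl fun j hj => ?_
    have hj' : j ≤ l := by simpa [Nat.lt_succ_iff] using hj
    rw [← Finset.prod_Ico_consecutive _ (show j + k ≤ l + k by omega)
        (show l + k ≤ l + b by omega), ← factorial_mul_prod_range_natCast_add k j,
      ← Finset.prod_Ico_add' (fun m : ℕ => y - (m : ℝ)) j l k, add_comm l k, add_comm l b,
      ← Finset.prod_Ico_add' (fun m : ℕ => y - (m : ℝ)) k b l]
    simp only [Nat.cast_add, sub_sub, add_comm]
    ring
  have outer := sum_choose_mul_prod_mul_prod_Ico b (y - l) (-(a : ℝ))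
  simp only [prod_range_neg_natCast_add] at outer
  have hR₁ : ∏ i ∈ Finset.range l, (x - (((l + a : ℕ) : ℝ) - 1 + i)) =
      ∏ i ∈ Finset.range l, (y + 1 - i) :=
    Finset.prod_congr rfl fun i _ => by rw [hy]; ring
  have hR₂ : ∏ j ∈ Finset.range b, (x - (2 * ((l + a : ℕ) : ℝ) + j)) =
      ∏ j ∈ Finset.range b, (y - l + -(a : ℝ) - j) :=
    Finset.prod_congr rfl fun i _ => by rw [hy]; push_cast; ring
  rw [hR₁, hR₂, ← outer, Finset.mul_sum]
  simp only [← sub_sub, ← hy, Finset.sum_mul]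
  rw [Finset.sum_comm]
  have shift (j : ℕ) (hj : j ∈ Finset.range (l + 1)) := sum_range_ite_le_mul_eq
    (g := fun k => (a.choose k : ℝ) * b.choose k) (N := min a b)
    (fun k hk => by
      rcases min_lt_iff.1 hk with h | h <;> simp [Nat.choose_eq_zero_of_lt h])
    (fun t => (-1 : ℝ) ^ t * (t.factorial : ℝ) * ∏ m ∈ Finset.Ico t (l + b), (y - m))
    (M := min (l + a) (l + b) + 1) (K := b + 1) (j := j)
    (by rw [Finset.mem_range] at hj; omega) (by omega)
  simp only [mul_assoc, ← Finset.mul_sum] at shift ⊢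
  rw [Finset.sum_congr rfl fun j hj => by rw [shift j hj]]
  simp only [Finset.mul_sum]
  rw [Finset.sum_comm]
  refine Finset.sum_congr rfl fun k hk => ?_
  have hk' : k ≤ b := by simpa [Nat.lt_succ_iff] using hk
  have h := congrArg (fun u => (-1) ^ k * ((a.choose k : ℝ) * b.choose k) * u) (inner k hk')
  simp only [Finset.mul_sum] at h
  trans
  · refine (Finset.sum_congr rfl fun j _ => ?_).trans h
    have hsq : (-1 : ℝ) ^ j * (-1) ^ j = 1 := by rw [← mul_pow]; simp
    rw [pow_add]
    linear_combination (l.choose j * (a.choose k * (b.choose k * ((-1) ^ k *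
      ((j + k).factorial * ∏ m ∈ Finset.Ico (j + k) (l + b), (y - m)))))) * hsq
  · ring
end

section
/- Fix natural numbers s₁ and r₁ and a real number x. Let H(s₁,r₁,x) be the real square matrix of size C(s₁+r₁,s₁) indexed by the s₁-element subsets of {1,…,s₁+r₁}, whose entry at a pair (S,T) is (−1)^f · f! · 2^f · Π_{i=f}^{r₁−1} (x² − x − 2(s₁+i)), where f = |S \ T|. Then the set of real eigenvalues of H(s₁,r₁,x) is exactly { Σ_{t=0}^{min(s₁,r₁)} [ Σ_{j=0}^{l} (−1)^j C(l,j) C(s₁−l, t−j) C(r₁−l, t−j) ] · (−1)^t · t! · 2^t · Π_{i=t}^{r₁−1} (x² − x − 2(s₁+i)) : 0 ≤ l ≤ min(s₁,r₁) }. -/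
open Finset Polynomial

theorem sum_prod_indicator_sub_mul_weight {α ι R : Type*} [Fintype α] [DecidableEq α] [CommRing R]
    {a b : ι → α} (hab : Function.Injective (Sum.elim a b)) (I : Finset ι) (p q : α → R) :
    ∑ T : Finset α, (∏ i ∈ I, ((if a i ∈ T then 1 else 0) - if b i ∈ T then 1 else 0)) *
        ((∏ e ∈ T, p e) * ∏ e ∈ Tᶜ, q e) =
      (∏ i ∈ I, (p (a i) * q (b i) - q (a i) * p (b i))) *
        ∏ e ∈ (I.image a ∪ I.image b)ᶜ, (p e + q e) := by
  classical
  have ha : ∀ i j, a i = a j → i = j := fun i j h => by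
    simpa using @hab (Sum.inl i) (Sum.inl j) h
  have hb : ∀ i j, b i = b j → i = j := fun i j h => by
    simpa using @hab (Sum.inr i) (Sum.inr j) h
  have hne : ∀ i j, a i ≠ b j := fun i j h => by
    simpa using @hab (Sum.inl i) (Sum.inr j) h
  induction I using Finset.induction_on generalizing q with
  | empty =>
    simp only [prod_empty, one_mul, image_empty, union_empty, compl_empty]
    rw [Finset.prod_add, Finset.powerset_univ]
    simp [Finset.compl_eq_univ_sdiff]
  | insert i I hi ih =>
    have key : ∀ (c : α) (T : Finset α), (if c ∈ T then (1 : R) else 0) *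
        ((∏ e ∈ T, p e) * ∏ e ∈ Tᶜ, q e) =
        (∏ e ∈ T, p e) * ∏ e ∈ Tᶜ, Function.update q c 0 e := by
      intro c T
      split_ifs with hc
      · rw [one_mul]
        congr 1
        refine prod_congr rfl fun e he => ?_
        rw [Function.update_of_ne]
        rintro rfl
        exact (mem_compl.1 he) hc
      · rw [zero_mul, prod_eq_zero (s := Tᶜ) (i := c) (by simpa using hc) (by simp), mul_zero]
    set K := (I.image a ∪ I.image b)ᶜ with hK
    have hsplit : K = insert (a i) (insert (b i)
        ((insert i I).image a ∪ (insert i I).image b)ᶜ) := by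
      ext e
      simp only [hK, mem_compl, mem_union, mem_image, mem_insert, image_insert]
      by_cases h1 : e = a i
      · subst h1
        simp only [true_or, iff_true]
        rintro (⟨j, hj, h⟩ | ⟨j, hj, h⟩)
        · exact hi (ha _ _ h ▸ hj)
        · exact hne _ _ h.symm
      by_cases h2 : e = b i
      · subst h2
        simp only [true_or, or_true, iff_true]
        rintro (⟨j, hj, h⟩ | ⟨j, hj, h⟩)
        · exact hne _ _ h
        · exact hi (hb _ _ h ▸ hj)
      simp [h1, h2]
    have hai : a i ∉ insert (b i) ((insert i I).image a ∪ (insert i I).image b)ᶜ := by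
      simp [hne]
    have hbi : b i ∉ ((insert i I).image a ∪ (insert i I).image b)ᶜ := by simp
    have hpI : ∀ c, (c = a i ∨ c = b i) →
        ∏ j ∈ I, (p (a j) * Function.update q c 0 (b j) - Function.update q c 0 (a j) * p (b j)) =
        ∏ j ∈ I, (p (a j) * q (b j) - q (a j) * p (b j)) := by
      intro c hc
      refine prod_congr rfl fun j hj => ?_
      have hji : j ≠ i := fun h => hi (h ▸ hj)
      have h1 : a j ≠ c := by
        rcases hc with rfl | rfl
        · exact fun h => hji (ha _ _ h)
        · exact hne _ _
      have h2 : b j ≠ c := by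
        rcases hc with rfl | rfl
        · exact (hne _ _).symm
        · exact fun h => hji (hb _ _ h)
      rw [Function.update_of_ne h1, Function.update_of_ne h2]
    have hrest : ∀ c, (c = a i ∨ c = b i) →
        ∏ e ∈ ((insert i I).image a ∪ (insert i I).image b)ᶜ, (p e + Function.update q c 0 e) =
        ∏ e ∈ ((insert i I).image a ∪ (insert i I).image b)ᶜ, (p e + q e) := by
      intro c hc
      refine prod_congr rfl fun e he => ?_
      rw [Function.update_of_ne]
      rintro rfl
      rcases hc with rfl | rfl <;> simp at he
    have step : ∀ T : Finset α,
        (∏ j ∈ insert i I, ((if a j ∈ T then (1 : R) else 0) - if b j ∈ T then 1 else 0)) *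
          ((∏ e ∈ T, p e) * ∏ e ∈ Tᶜ, q e) =
        (∏ j ∈ I, ((if a j ∈ T then (1 : R) else 0) - if b j ∈ T then 1 else 0)) *
          ((∏ e ∈ T, p e) * ∏ e ∈ Tᶜ, Function.update q (a i) 0 e) -
        (∏ j ∈ I, ((if a j ∈ T then (1 : R) else 0) - if b j ∈ T then 1 else 0)) *
          ((∏ e ∈ T, p e) * ∏ e ∈ Tᶜ, Function.update q (b i) 0 e) := by
      intro T
      rw [← key, ← key, prod_insert hi]
      ring
    simp_rw [step]
    rw [sum_sub_distrib, ih, ih, hpI _ (Or.inl rfl), hpI _ (Or.inr rfl), hsplit,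
      prod_insert hai, prod_insert hbi, prod_insert hai, prod_insert hbi,
      hrest _ (Or.inl rfl), hrest _ (Or.inr rfl), prod_insert hi,
      Function.update_self, Function.update_self, Function.update_of_ne (hne i i),
      Function.update_of_ne (hne i i).symm]
    ring

theorem coeff_coeff_eberlein (l m n t : ℕ) :
    (((1 - C (X : ℝ[X]) * X) ^ l * ((1 + C X) ^ m * (1 + X) ^ n)).coeff t).coeff t =
      ∑ j ∈ range (l + 1), (-1 : ℝ) ^ j * (l.choose j : ℝ) *
        (if j ≤ t then (m.choose (t - j) * n.choose (t - j) : ℝ) else 0) := by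
  have h1 : (1 - C (X : ℝ[X]) * X) ^ l * ((1 + C X) ^ m * (1 + X) ^ n) =
      ∑ j ∈ range (l + 1), C (C ((-1 : ℝ) ^ j * (l.choose j : ℝ)) * ((1 + X) ^ m * X ^ j)) *
        ((1 + X) ^ n * X ^ j) := by
    have h0 : (1 : ℝ[X][X]) - C (X : ℝ[X]) * X = -1 * (C (X : ℝ[X]) * X) + 1 := by ring
    rw [h0, add_pow, sum_mul]
    refine sum_congr rfl fun j _ => ?_
    simp only [map_mul, map_pow, map_add, map_one, map_neg, map_natCast, one_pow]
    rw [mul_pow, mul_pow]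
    ring
  rw [h1, finsetSum_coeff, finsetSum_coeff]
  refine sum_congr rfl fun j _ => ?_
  rw [coeff_C_mul, coeff_mul_X_pow']
  split_ifs with h
  · rw [coeff_one_add_X_pow, ← C_eq_natCast, coeff_mul_C, coeff_C_mul, coeff_mul_X_pow', if_pos h,
      coeff_one_add_X_pow]
    ring
  · simp

/-- The signed indicator of the sets `T` that meet every pair `{a i, b i}` in exactly one point. -/
def pairVector {α ι : Type*} [DecidableEq α] [Fintype ι] (a b : ι → α) (T : Finset α) : ℝ :=
  ∏ i, ((if a i ∈ T then 1 else 0) - if b i ∈ T then 1 else 0)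

/-- The value at `l` of the `t`-th Eberlein polynomial of the Johnson scheme `J(s + r, s)`. -/
def eberlein (s r l t : ℕ) : ℝ :=
  ∑ j ∈ range (l + 1), (-1 : ℝ) ^ j * (l.choose j : ℝ) *
    (if j ≤ t then ((s - l).choose (t - j) * (r - l).choose (t - j) : ℝ) else 0)

theorem card_sdiff_eq_iff {α : Type*} [DecidableEq α] {S T : Finset α} {s t : ℕ} (hS : #S = s) :
    (#T = s ∧ #(S \ T) = t) ↔ (#(T \ S) = t ∧ #(S \ T) = t) := by
  have h1 := card_sdiff_add_card_inter S T
  have h2 := card_sdiff_add_card_inter T S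
  rw [inter_comm] at h2
  omega

theorem sum_subtype_card {α : Type*} [Fintype α] {s : ℕ} (F : Finset α → ℝ) :
    ∑ U : {S : Finset α // #S = s}, F U.val = ∑ U with #U = s, F U :=
  (sum_subtype _ (by simp) F).symm

/-- The matrix indexed by `s`-subsets whose `(S, T)` entry is `f #(S \ T)`. -/
def distMatrix (α : Type*) [DecidableEq α] (s : ℕ) (f : ℕ → ℝ) :
    Matrix {S : Finset α // #S = s} {S : Finset α // #S = s} ℝ :=
  Matrix.of fun S T => f #(S.val \ T.val)

section

variable {α : Type*} [Fintype α] [DecidableEq α]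

theorem card_inter_of_pairVector_ne_zero {ι : Type*} [Fintype ι] {a b : ι → α}
    (hab : Function.Injective (Sum.elim a b)) {S : Finset α} (hS : pairVector a b S ≠ 0) :
    #(S ∩ (univ.image a ∪ univ.image b)) = Fintype.card ι ∧
      #(Sᶜ ∩ (univ.image a ∪ univ.image b)) = Fintype.card ι := by
  classical
  have h : ∀ i, (a i ∈ S ↔ b i ∉ S) := by
    intro i
    have := prod_ne_zero_iff.1 hS i (mem_univ i)
    by_contra h
    by_cases h1 : a i ∈ S <;> by_cases h2 : b i ∈ S <;> simp_all
  have inj1 : Function.Injective fun i => if a i ∈ S then a i else b i := by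
    intro i j hij
    have e : (fun i => if a i ∈ S then a i else b i) =
      fun i => Sum.elim a b (if a i ∈ S then Sum.inl i else Sum.inr i) := by
      ext i; split_ifs <;> rfl
    rw [e] at hij
    have := hab hij
    split_ifs at this <;> simpa using this
  have inj2 : Function.Injective fun i => if a i ∈ S then b i else a i := by
    intro i j hij
    have e : (fun i => if a i ∈ S then b i else a i) =
      fun i => Sum.elim a b (if a i ∈ S then Sum.inr i else Sum.inl i) := by
      ext i; split_ifs <;> rfl
    rw [e] at hij
    have := hab hij
    split_ifs at this <;> simpa using this
  constructor
  · rw [← Finset.card_univ, ← card_image_of_injective univ inj1]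
    congr 1
    ext e
    simp only [mem_inter, mem_union, mem_image, mem_univ, true_and]
    constructor
    · rintro ⟨he, ⟨i, rfl⟩ | ⟨i, rfl⟩⟩
      · exact ⟨i, if_pos he⟩
      · exact ⟨i, if_neg fun h' => (h i).1 h' he⟩
    · rintro ⟨i, rfl⟩
      by_cases hi : a i ∈ S
      · simp [hi]
      · simpa [hi] using (not_not.1 fun h' => hi ((h i).2 h'))
  · rw [← Finset.card_univ, ← card_image_of_injective univ inj2]
    congr 1
    ext e
    simp only [mem_inter, mem_union, mem_image, mem_univ, true_and, mem_compl]
    constructor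
    · rintro ⟨he, ⟨i, rfl⟩ | ⟨i, rfl⟩⟩
      · exact ⟨i, if_neg he⟩
      · exact ⟨i, if_pos ((h i).2 he)⟩
    · rintro ⟨i, rfl⟩
      by_cases hi : a i ∈ S
      · simpa [hi] using (h i).1 hi
      · simp [hi]

theorem prod_mul_prod_compl_ite {R : Type*} [CommRing R] (S T : Finset α) (x y : R) :
    (∏ e ∈ T, if e ∈ S then 1 else y) * ∏ e ∈ Tᶜ, (if e ∈ S then x else 1) =
      y ^ #(T \ S) * x ^ #(S \ T) := by
  rw [prod_ite, prod_ite]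
  simp only [prod_const_one, one_mul, mul_one, prod_const]
  congr 3
  · ext; simp
  · ext; simp [and_comm]

theorem sum_pairVector {s r l : ℕ} (hα : Fintype.card α = s + r) {a b : Fin l → α}
    (hab : Function.Injective (Sum.elim a b)) {S : Finset α} (hS : #S = s) (t : ℕ) :
    ∑ T with #T = s ∧ #(S \ T) = t, pairVector a b T = eberlein s r l t * pairVector a b S := by
  have key := sum_prod_indicator_sub_mul_weight hab univ
    (fun e => if e ∈ S then (1 : ℝ[X][X]) else X) (fun e => if e ∈ S then C X else 1)
  have hv : ∀ T : Finset α, (∏ i, ((if a i ∈ T then (1 : ℝ[X][X]) else 0) -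
      if b i ∈ T then 1 else 0)) = C (C (pairVector a b T)) := by
    intro T
    simp [pairVector, map_prod, apply_ite C]
  have hdet : ∀ i, ((if a i ∈ S then (1 : ℝ[X][X]) else X) * (if b i ∈ S then C X else 1) -
      (if a i ∈ S then C X else 1) * (if b i ∈ S then 1 else X)) =
      ((if a i ∈ S then (1 : ℝ[X][X]) else 0) - if b i ∈ S then 1 else 0) * (1 - C X * X) := by
    intro i
    split_ifs <;> ring
  simp_rw [prod_mul_prod_compl_ite, hdet] at key
  rw [prod_mul_distrib] at key
  simp_rw [hv] at key
  have key' := congrArg (fun P : ℝ[X][X] => (P.coeff t).coeff t) key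
  simp only [finsetSum_coeff] at key'
  have hL : ∀ T : Finset α,
      ((C (C (pairVector a b T)) * ((X : ℝ[X][X]) ^ #(T \ S) * C X ^ #(S \ T))).coeff t).coeff t =
      if #T = s ∧ #(S \ T) = t then pairVector a b T else 0 := by
    intro T
    simp only [card_sdiff_eq_iff hS]
    rw [coeff_C_mul, ← C_pow, coeff_mul_C, coeff_C_mul, coeff_X_pow]
    by_cases h1 : t = #(T \ S)
    · by_cases h2 : t = #(S \ T)
      · simp [← h1, ← h2]
      · simp [h1.symm, Ne.symm h2, coeff_X_pow, h2]
    · simp [h1, Ne.symm h1]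
  simp_rw [hL] at key'
  rw [sum_filter, key']
  by_cases h0 : pairVector a b S = 0
  · simp [h0]
  obtain ⟨c1, c2⟩ := card_inter_of_pairVector_ne_zero hab h0
  have e1 : #(S \ (univ.image a ∪ univ.image b)) = s - l := by
    have := card_sdiff_add_card_inter S (univ.image a ∪ univ.image b)
    simp at c1
    omega
  have e2 : #(Sᶜ \ (univ.image a ∪ univ.image b)) = r - l := by
    have := card_sdiff_add_card_inter Sᶜ (univ.image a ∪ univ.image b)
    have h3 := card_compl S
    simp at c2
    omega
  have hprod : ∏ e ∈ (univ.image a ∪ univ.image b)ᶜ,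
      ((if e ∈ S then (1 : ℝ[X][X]) else X) + if e ∈ S then C X else 1) =
      (1 + C X) ^ (s - l) * (1 + X) ^ (r - l) := by
    rw [← e1, ← e2, ← prod_const, ← prod_const, ← prod_filter_mul_prod_filter_not _ (· ∈ S)]
    congr 1
    · refine prod_congr (by ext; simp [and_comm]) fun e he => ?_
      simp only [mem_sdiff] at he
      simp [he.1]
    · refine prod_congr (by ext; simp [and_comm]) fun e he => ?_
      simp only [mem_sdiff, mem_compl] at he
      simp [he.1, add_comm]
  rw [hprod, prod_const, card_univ, Fintype.card_fin, mul_assoc, coeff_C_mul, coeff_C_mul,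
    coeff_coeff_eberlein, eberlein, mul_comm]


theorem prod_membership_weights {R : Type*} [CommRing R] (S T : Finset α) (x y z w : R) :
    ∏ e : α, (if e ∈ S then if e ∈ T then x else y else if e ∈ T then z else w) =
      x ^ #(S ∩ T) * y ^ #(S \ T) * (z ^ #(T \ S) * w ^ #(S ∪ T)ᶜ) := by
  rw [prod_ite, prod_ite, prod_ite]
  simp only [prod_const]
  congr 3 <;> congr 1 <;> ext <;> simp [and_comm]

theorem sum_weight_eq {R : Type*} [CommRing R] {s r : ℕ} (hα : Fintype.card α = s + r)
    {S T : Finset α} (hS : #S = s) (hT : #T = s) (x y z : R) :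
    ∑ U : Finset α, x ^ #U * y ^ #(S \ U) * z ^ #(U \ T) =
      (x + y) ^ (s - #(S \ T)) * (x * z + y) ^ #(S \ T) *
        ((x + 1) ^ #(S \ T) * (x * z + 1) ^ (r - #(S \ T))) := by
  have h1 : s - #(S \ T) = #(S ∩ T) := by
    have := card_sdiff_add_card_inter S T
    omega
  have h2 : #(S \ T) = #(T \ S) := by
    have := card_sdiff_add_card_inter S T
    have h := card_sdiff_add_card_inter T S
    rw [inter_comm] at h
    omega
  have h3 : r - #(S \ T) = #(S ∪ T)ᶜ := by
    have := card_sdiff_add_card S T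
    rw [card_compl]
    omega
  rw [h1, h3]
  nth_rewrite 2 [h2]
  rw [← prod_membership_weights]
  have h4 : ∀ e, (if e ∈ S then if e ∈ T then x + y else x * z + y
      else if e ∈ T then x + 1 else x * z + 1) =
      x * (if e ∈ T then 1 else z) + if e ∈ S then y else 1 := by
    intro e
    split_ifs <;> ring
  simp_rw [h4]
  rw [prod_add, powerset_univ]
  refine sum_congr rfl fun U _ => ?_
  rw [prod_mul_distrib, prod_const, prod_ite, prod_ite]
  simp only [prod_const_one, one_mul, mul_one, prod_const]
  rw [mul_assoc, mul_assoc, mul_comm (y ^ _)]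
  congr 4
  · ext; simp
  · ext; simp [and_comm]

theorem sum_mul_eq_of_card_sdiff_eq {s r : ℕ} (hα : Fintype.card α = s + r) (f g : ℕ → ℝ)
    {S T S' T' : Finset α} (hS : #S = s) (hT : #T = s) (hS' : #S' = s) (hT' : #T' = s)
    (h : #(S \ T) = #(S' \ T')) :
    ∑ U with #U = s, f #(S \ U) * g #(U \ T) = ∑ U with #U = s, f #(S' \ U) * g #(U \ T') := by
  let φ : MvPolynomial (Fin 3) ℝ →ₗ[ℝ] ℝ := (MvPolynomial.basisMonomials (Fin 3) ℝ).constr ℝ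
    fun n => if n 0 = s then f (n 1) * g (n 2) else 0
  have hφ : ∀ i j k, φ (MvPolynomial.X 0 ^ i * MvPolynomial.X 1 ^ j * MvPolynomial.X 2 ^ k) =
      if i = s then f j * g k else 0 := by
    intro i j k
    have h1 : (MvPolynomial.X 0 ^ i * MvPolynomial.X 1 ^ j * MvPolynomial.X 2 ^ k :
        MvPolynomial (Fin 3) ℝ) = MvPolynomial.basisMonomials (Fin 3) ℝ
          (Finsupp.single 0 i + Finsupp.single 1 j + Finsupp.single 2 k) := by
      simp [MvPolynomial.X_pow_eq_monomial, MvPolynomial.monomial_mul]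
    rw [h1, Module.Basis.constr_basis]
    simp
  have e1 := sum_weight_eq hα hS hT (MvPolynomial.X 0 : MvPolynomial (Fin 3) ℝ)
    (MvPolynomial.X 1) (MvPolynomial.X 2)
  have e2 := sum_weight_eq hα hS' hT' (MvPolynomial.X 0 : MvPolynomial (Fin 3) ℝ)
    (MvPolynomial.X 1) (MvPolynomial.X 2)
  rw [← h] at e2
  have e3 := congrArg φ (e1.trans e2.symm)
  simp only [map_sum, hφ] at e3
  rwa [sum_filter, sum_filter]

/-- The Bose-Mesner algebra of the Johnson scheme. -/
def distSubalgebra {s r : ℕ} (hα : Fintype.card α = s + r) :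
    Subalgebra ℝ (Matrix {S : Finset α // #S = s} {S : Finset α // #S = s} ℝ) where
  carrier := Set.range (distMatrix α s)
  add_mem' := by
    rintro _ _ ⟨f, rfl⟩ ⟨g, rfl⟩
    exact ⟨f + g, rfl⟩
  mul_mem' := by
    classical
    rintro _ _ ⟨f, rfl⟩ ⟨g, rfl⟩
    refine ⟨fun d => if h : ∃ P : {S : Finset α // #S = s} × {S : Finset α // #S = s},
      #(P.1.val \ P.2.val) = d then
        (distMatrix α s f * distMatrix α s g) h.choose.1 h.choose.2 else 0, ?_⟩
    ext S T
    have h : ∃ P : {S : Finset α // #S = s} × {S : Finset α // #S = s},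
      #(P.1.val \ P.2.val) = #(S.val \ T.val) := ⟨(S, T), rfl⟩
    change dite _ _ _ = _
    rw [dif_pos h, Matrix.mul_apply, Matrix.mul_apply]
    simp only [distMatrix, Matrix.of_apply]
    rw [sum_subtype_card fun U => f #(h.choose.1.val \ U) * g #(U \ h.choose.2.val),
      sum_subtype_card fun U => f #(S.val \ U) * g #(U \ T.val)]
    exact sum_mul_eq_of_card_sdiff_eq hα f g h.choose.1.2 h.choose.2.2 S.2 T.2 h.choose_spec
  algebraMap_mem' := by
    intro c
    refine ⟨fun d => if d = 0 then c else 0, ?_⟩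
    ext S T
    have h : #(S.val \ T.val) = 0 ↔ S = T := by
      rw [card_eq_zero, sdiff_eq_empty_iff_subset]
      exact ⟨fun h => Subtype.ext (eq_of_subset_of_card_le h (by rw [S.2, T.2])),
        fun h => h ▸ Subset.rfl⟩
    simp only [distMatrix, Matrix.of_apply, h, Matrix.algebraMap_matrix_apply, Algebra.algebraMap_self,
      RingHom.id_apply]

/-- The eigenvalue of `distMatrix` on the `l`-th eigenspace of the Johnson scheme. -/
def distEigenvalue (s r : ℕ) (f : ℕ → ℝ) (l : ℕ) : ℝ :=
  ∑ t ∈ range (min s r + 1), eberlein s r l t * f t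

theorem card_sdiff_le_min {s r : ℕ} (hα : Fintype.card α = s + r) {S T : Finset α}
    (hS : #S = s) (hT : #T = s) : #(S \ T) ≤ min s r := by
  have h1 := card_sdiff_add_card_inter S T
  have h2 := card_sdiff_add_card S T
  have h3 := card_le_univ (S ∪ T)
  omega

theorem distMatrix_mulVec_pairVector {s r l : ℕ} (hα : Fintype.card α = s + r) {a b : Fin l → α}
    (hab : Function.Injective (Sum.elim a b)) (f : ℕ → ℝ) :
    (distMatrix α s f).mulVec (fun S => pairVector a b S.val) =
      distEigenvalue s r f l • fun S => pairVector a b S.val := by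
  ext S
  simp only [Matrix.mulVec, dotProduct, distMatrix, Matrix.of_apply, Pi.smul_apply, smul_eq_mul,
    distEigenvalue]
  rw [sum_subtype_card fun U => f #(S.val \ U) * pairVector a b U, sum_mul,
    ← sum_fiberwise_of_maps_to (t := range (min s r + 1)) (g := fun U => #(S.val \ U))]
  · refine sum_congr rfl fun t _ => ?_
    rw [mul_right_comm, ← sum_pairVector hα hab S.2 t, sum_mul, filter_filter]
    refine sum_congr rfl fun U hU => ?_
    rw [(mem_filter.1 hU).2.2, mul_comm]
  · intro U hU
    have := card_sdiff_le_min hα S.2 (mem_filter.1 hU).2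
    rw [mem_range]
    omega

end

theorem exists_eigenvector {s r l : ℕ} (hl : l ≤ min s r) :
    ∃ v : {S : Finset (Fin (s + r)) // #S = s} → ℝ, v ≠ 0 ∧ ∀ f,
      (distMatrix (Fin (s + r)) s f).mulVec v = distEigenvalue s r f l • v := by
  have hs : l ≤ s := hl.trans (min_le_left _ _)
  have hr : l ≤ r := hl.trans (min_le_right _ _)
  let a : Fin l → Fin (s + r) := fun i => Fin.castAdd r (Fin.castLE hs i)
  let b : Fin l → Fin (s + r) := fun i => Fin.natAdd s (Fin.castLE hr i)
  have hab : Function.Injective (Sum.elim a b) := by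
    rintro (i | i) (j | j) h <;> simp only [Sum.elim_inl, Sum.elim_inr, a, b, Fin.ext_iff,
      Fin.val_castAdd, Fin.val_natAdd, Fin.val_castLE] at h
    · rw [Fin.ext h]
    · omega
    · omega
    · rw [Fin.ext (Nat.add_left_cancel h)]
  refine ⟨_, ?_, distMatrix_mulVec_pairVector (Fintype.card_fin _) hab⟩
  intro h
  have h1 := congrFun h ⟨univ.image (Fin.castAdd r), by
    rw [card_image_of_injective _ (Fin.castAdd_injective _ _), card_univ, Fintype.card_fin]⟩
  have h2 : ∀ i, a i ∈ univ.image (Fin.castAdd (n := s) r) := fun i => by simp [a]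
  have h3 : ∀ i, b i ∉ univ.image (Fin.castAdd (n := s) r) := fun i => by
    simp only [mem_image, mem_univ, true_and, b, Fin.ext_iff, Fin.val_castAdd, Fin.val_natAdd]
    rintro ⟨j, hj⟩
    omega
  simp [pairVector, h2, h3] at h1

theorem eberlein_one {s r l : ℕ} (hl : l ≤ min s r) :
    eberlein s r l 1 = (s - l) * (r - l) - l := by
  have hs : l ≤ s := hl.trans (min_le_left _ _)
  have hr : l ≤ r := hl.trans (min_le_right _ _)
  have h : eberlein s r l 1 = ∑ j ∈ range 2, (-1 : ℝ) ^ j * (l.choose j : ℝ) *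
    (if j ≤ 1 then ((s - l).choose (1 - j) * (r - l).choose (1 - j) : ℝ) else 0) := by
    rcases l with _ | l
    · simp [eberlein, sum_range_succ]
    · refine (sum_subset (range_subset_range.2 (by omega)) fun j _ hj => ?_).symm
      rw [if_neg (by simpa using hj), mul_zero]
  rw [h, sum_range_succ, sum_range_one]
  simp [Nat.cast_sub hs, Nat.cast_sub hr]
  ring

theorem exists_distEigenvalue_injective (s r : ℕ) :
    ∃ f, Function.Injective fun l : Fin (min s r + 1) => distEigenvalue s r f l := by
  refine ⟨fun t => if t = 1 then 1 else 0, fun l k h => ?_⟩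
  rcases Nat.eq_zero_or_pos (min s r) with h0 | h0
  · ext
    omega
  have h1 : ∀ l : Fin (min s r + 1), distEigenvalue s r (fun t => if t = 1 then 1 else 0) l =
      ((s : ℝ) - (l : ℕ)) * (r - (l : ℕ)) - (l : ℕ) := by
    intro l
    rw [← eberlein_one (Nat.lt_succ_iff.1 l.2)]
    simp [distEigenvalue, h0]
  simp only [h1] at h
  have hl : (l : ℕ) ≤ s ∧ (l : ℕ) ≤ r := by omega
  have hk : (k : ℕ) ≤ s ∧ (k : ℕ) ≤ r := by omega
  have hl1 : ((l : ℕ) : ℝ) ≤ s := mod_cast hl.1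
  have hl2 : ((l : ℕ) : ℝ) ≤ r := mod_cast hl.2
  have hk1 : ((k : ℕ) : ℝ) ≤ s := mod_cast hk.1
  have hk2 : ((k : ℕ) : ℝ) ≤ r := mod_cast hk.2
  have h2 : (((l : ℕ) : ℝ) - (k : ℕ)) * (s + r + 1 - (l : ℕ) - (k : ℕ)) = 0 := by linarith
  rcases mul_eq_zero.1 h2 with h3 | h3
  · exact Fin.ext (by exact_mod_cast sub_eq_zero.1 h3)
  · linarith

theorem aeval_mulVec_of_mulVec_eq_smul {n : Type*} [Fintype n] [DecidableEq n] {M : Matrix n n ℝ}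
    {v : n → ℝ} {θ : ℝ} (h : M.mulVec v = θ • v) (p : ℝ[X]) :
    (aeval M p).mulVec v = p.eval θ • v := by
  induction p using Polynomial.induction_on' with
  | add p q hp hq => rw [map_add, Matrix.add_mulVec, hp, hq, eval_add, add_smul]
  | monomial k c =>
    have hk : (M ^ k).mulVec v = θ ^ k • v := by
      induction k with
      | zero => simp
      | succ k ih =>
        rw [pow_succ, ← Matrix.mulVec_mulVec, h, Matrix.mulVec_smul, ih, smul_smul, pow_succ']
    rw [aeval_monomial, Algebra.algebraMap_eq_smul_one, smul_mul_assoc, one_mul,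
      Matrix.smul_mulVec, hk, smul_smul, eval_monomial]

theorem exists_distMatrix_eq_aeval {s r : ℕ} (f : ℕ → ℝ) (p : ℝ[X]) :
    ∃ g, distMatrix (Fin (s + r)) s g = aeval (distMatrix (Fin (s + r)) s f) p ∧
      ∀ l ≤ min s r, distEigenvalue s r g l = p.eval (distEigenvalue s r f l) := by
  have hmem : aeval (distMatrix (Fin (s + r)) s f) p ∈
      distSubalgebra (Fintype.card_fin (s + r)) :=
    Algebra.adjoin_le (Set.singleton_subset_iff.2 (Set.mem_range_self f))
      (aeval_mem_adjoin_singleton ℝ _)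
  obtain ⟨g, hg⟩ := hmem
  refine ⟨g, hg, fun l hl => ?_⟩
  obtain ⟨v, hv, h⟩ := exists_eigenvector hl
  have h1 := aeval_mulVec_of_mulVec_eq_smul (h f) p
  rw [← hg, h g] at h1
  exact smul_left_injective ℝ hv h1

theorem distMatrix_eq_zero {s r : ℕ} {f : ℕ → ℝ} (hf : ∀ l ≤ min s r, distEigenvalue s r f l = 0) :
    distMatrix (Fin (s + r)) s f = 0 := by
  let Λ : (Fin (min s r + 1) → ℝ) →ₗ[ℝ] (Fin (min s r + 1) → ℝ) :=
    Matrix.mulVecLin (Matrix.of fun l t => eberlein s r l t)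
  have hΛ : ∀ (g : ℕ → ℝ) l, Λ (fun t => g t) l = distEigenvalue s r g l := fun g l =>
    Fin.sum_univ_eq_sum_range (fun t => eberlein s r l t * g t) _
  have hsurj : Function.Surjective Λ := by
    intro y
    obtain ⟨f₀, hf₀⟩ := exists_distEigenvalue_injective s r
    obtain ⟨g, -, hg⟩ := exists_distMatrix_eq_aeval (s := s) (r := r) f₀
      (Lagrange.interpolate univ (fun l : Fin (min s r + 1) => distEigenvalue s r f₀ l) y)
    refine ⟨fun t => g t, ?_⟩
    ext l
    rw [hΛ, hg l (Nat.lt_succ_iff.1 l.2)]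
    exact Lagrange.eval_interpolate_at_node y (hf₀.injOn) (mem_univ l)
  have hinj := LinearMap.injective_iff_surjective.2 hsurj
  have h0 : (fun t : Fin (min s r + 1) => f t) = 0 := by
    apply hinj
    ext l
    rw [hΛ, hf l (Nat.lt_succ_iff.1 l.2), map_zero, Pi.zero_apply]
  ext S T
  have := card_sdiff_le_min (Fintype.card_fin (s + r)) S.2 T.2
  exact congrFun h0 ⟨_, Nat.lt_succ_iff.2 this⟩

theorem eigenvalue_distMatrix_iff {s r : ℕ} (f : ℕ → ℝ) (μ : ℝ) :
    (∃ v, v ≠ 0 ∧ (distMatrix (Fin (s + r)) s f).mulVec v = μ • v) ↔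
      ∃ l ≤ min s r, μ = distEigenvalue s r f l := by
  constructor
  · rintro ⟨v, hv, h⟩
    obtain ⟨g, hg, hg'⟩ := exists_distMatrix_eq_aeval (s := s) (r := r) f
      (∏ l ∈ range (min s r + 1), (X - C (distEigenvalue s r f l)))
    have h1 := aeval_mulVec_of_mulVec_eq_smul h
      (∏ l ∈ range (min s r + 1), (X - C (distEigenvalue s r f l)))
    rw [← hg, distMatrix_eq_zero, Matrix.zero_mulVec] at h1
    · have h2 := (smul_eq_zero.1 h1.symm).resolve_right hv
      rw [eval_prod, prod_eq_zero_iff] at h2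
      obtain ⟨l, hl, h3⟩ := h2
      refine ⟨l, Nat.lt_succ_iff.1 (mem_range.1 hl), ?_⟩
      simpa [sub_eq_zero] using h3
    · intro l hl
      rw [hg' l hl, eval_prod]
      exact prod_eq_zero (mem_range.2 (Nat.lt_succ_iff.2 hl)) (by simp)
  · rintro ⟨l, hl, rfl⟩
    obtain ⟨v, hv, h⟩ := exists_eigenvector hl
    exact ⟨v, hv, h f⟩

/-- The set of real eigenvalues of the reduced `{e}`-part Gram-matrix block
`H(s₁,r₁,x)` of the algebra of `ℤ₂`-relations (and the signed partition algebra) is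
exactly the set of values
`∑_t [∑_j (-1)^j C(l,j) C(s₁-l,t-j) C(r₁-l,t-j)] (-1)^t t! 2^t ∏_{i=t}^{r₁-1}(x²-x-2(s₁+i))`
for `0 ≤ l ≤ min(s₁,r₁)`. -/
theorem stmt_14 (s1 r1 : ℕ) (x : ℝ)
    (H : Matrix {S : Finset (Fin (s1 + r1)) // S.card = s1}
                {S : Finset (Fin (s1 + r1)) // S.card = s1} ℝ)
    (hH : ∀ S T, H S T =
      (-1 : ℝ) ^ ((S.val \ T.val).card) * (((S.val \ T.val).card).factorial : ℝ) *
        2 ^ ((S.val \ T.val).card) *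
        ∏ i ∈ Finset.Ico ((S.val \ T.val).card) r1,
          (x ^ 2 - x - 2 * ((s1 : ℝ) + (i : ℝ)))) :
    ∀ μ : ℝ,
      (∃ v : {S : Finset (Fin (s1 + r1)) // S.card = s1} → ℝ,
        v ≠ 0 ∧ H.mulVec v = μ • v) ↔
      ∃ l ≤ min s1 r1, μ =
        ∑ t ∈ Finset.range (min s1 r1 + 1),
          (∑ j ∈ Finset.range (l + 1),
            (-1 : ℝ) ^ j * (l.choose j : ℝ) *
              (if j ≤ t then
                ((s1 - l).choose (t - j) * (r1 - l).choose (t - j) : ℝ) else 0)) *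
          ((-1 : ℝ) ^ t * (t.factorial : ℝ) * 2 ^ t *
            ∏ i ∈ Finset.Ico t r1, (x ^ 2 - x - 2 * ((s1 : ℝ) + (i : ℝ)))) := by
  obtain rfl : H = distMatrix (Fin (s1 + r1)) s1 fun t =>
      (-1 : ℝ) ^ t * (t.factorial : ℝ) * 2 ^ t *
        ∏ i ∈ Finset.Ico t r1, (x ^ 2 - x - 2 * ((s1 : ℝ) + (i : ℝ))) := by
    ext S T
    exact hH S T
  exact eigenvalue_distMatrix_iff _
end

section
/- Let x_0, x_1, x_2 be real numbers and let A be the symmetric diagram matrix A^{5,3} (the case s = 3, r = 2): the 10×10 real matrix indexed by the 3-element subsets S, T of {1,…,5} whose (S,T)-entry is x_{2 − |S \ T|}. Then the set of real eigenvalues of A is exactly {x_2 + 6x_1 + 3x_0, x_2 − 2x_1 + x_0, x_2 + x_1 − 2x_0}. -/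
/-- The 0-1 matrix recording the pairs `(S, T)` of 3-subsets of a 5-set with `|S \ T| = k`. -/
def johnsonMatrix (k : ℕ) : Matrix {S : Finset (Fin 5) // S.card = 3}
    {S : Finset (Fin 5) // S.card = 3} ℤ :=
  Matrix.of fun S T => if (S.val \ T.val).card = k then 1 else 0

theorem johnsonMatrix_zero : johnsonMatrix 0 = 1 := by decide +kernel

theorem johnsonMatrix_one_mul_one :
    johnsonMatrix 1 * johnsonMatrix 1 = 6 + 3 * johnsonMatrix 1 + 4 * johnsonMatrix 2 := by
  decide +kernel

theorem johnsonMatrix_one_mul_two :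
    johnsonMatrix 1 * johnsonMatrix 2 = 2 * johnsonMatrix 1 + 2 * johnsonMatrix 2 := by
  decide +kernel

theorem johnsonMatrix_two_mul_one :
    johnsonMatrix 2 * johnsonMatrix 1 = 2 * johnsonMatrix 1 + 2 * johnsonMatrix 2 := by
  decide +kernel

theorem johnsonMatrix_two_mul_two :
    johnsonMatrix 2 * johnsonMatrix 2 = 3 + johnsonMatrix 1 := by
  decide +kernel

theorem card_sdiff_le_two (S T : {S : Finset (Fin 5) // S.card = 3}) :
    (S.val \ T.val).card ≤ 2 := by
  revert S T
  decide +kernel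

/-- A common integer eigenvector of the Johnson matrices is an eigenvector of every real linear
combination of them. -/
theorem exists_eigenvector_of_johnsonMatrix (a b c : ℝ)
    (w : {S : Finset (Fin 5) // S.card = 3} → ℤ) (p q : ℤ) (hw : w ≠ 0)
    (h1 : (johnsonMatrix 1).mulVec w = p • w) (h2 : (johnsonMatrix 2).mulVec w = q • w) :
    ∃ v : {S : Finset (Fin 5) // S.card = 3} → ℝ, v ≠ 0 ∧
      (a • 1 + b • (Int.castRingHom ℝ).mapMatrix (johnsonMatrix 1) +
        c • (Int.castRingHom ℝ).mapMatrix (johnsonMatrix 2)).mulVec v = (a + p * b + q * c) • v := by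
  have key : ∀ (M : Matrix {S : Finset (Fin 5) // S.card = 3}
      {S : Finset (Fin 5) // S.card = 3} ℤ) (r : ℤ), M.mulVec w = r • w →
      ((Int.castRingHom ℝ).mapMatrix M).mulVec (fun S => (w S : ℝ)) =
        (r : ℝ) • fun S => (w S : ℝ) := by
    intro M r h
    funext S
    have := congrArg (Int.cast : ℤ → ℝ) (congrFun h S)
    simpa [Matrix.mulVec, dotProduct] using this
  refine ⟨fun S => (w S : ℝ), fun h => hw ?_, ?_⟩
  · funext S
    simpa using congrFun h S
  · rw [Matrix.add_mulVec, Matrix.add_mulVec, Matrix.smul_mulVec, Matrix.smul_mulVec,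
      Matrix.smul_mulVec, key _ p h1, key _ q h2, Matrix.one_mulVec]
    module

/-- A linear combination of the Johnson matrices is annihilated by the product of the linear
factors belonging to its three eigenvalues. -/
theorem johnsonMatrix_annihilator (a b c : ℝ) :
    let A := a • 1 + b • (Int.castRingHom ℝ).mapMatrix (johnsonMatrix 1) +
        c • (Int.castRingHom ℝ).mapMatrix (johnsonMatrix 2)
    (A - (a + 6 * b + 3 * c) • 1) * ((A - (a - 2 * b + c) • 1) * (A - (a + b - 2 * c) • 1)) = 0 := by
  have h11 := congrArg (Int.castRingHom ℝ).mapMatrix johnsonMatrix_one_mul_one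
  have h12 := congrArg (Int.castRingHom ℝ).mapMatrix johnsonMatrix_one_mul_two
  have h21 := congrArg (Int.castRingHom ℝ).mapMatrix johnsonMatrix_two_mul_one
  have h22 := congrArg (Int.castRingHom ℝ).mapMatrix johnsonMatrix_two_mul_two
  simp only [map_mul, map_add, map_ofNat] at h11 h12 h21 h22
  intro A
  dsimp only [A]
  generalize (Int.castRingHom ℝ).mapMatrix (johnsonMatrix 1) = B at *
  generalize (Int.castRingHom ℝ).mapMatrix (johnsonMatrix 2) = C at *
  have e (n : ℕ) [n.AtLeastTwo] : (OfNat.ofNat n : Matrix {S : Finset (Fin 5) // S.card = 3}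
      {S : Finset (Fin 5) // S.card = 3} ℝ) = (OfNat.ofNat n : ℝ) • 1 := by
    rw [← Algebra.algebraMap_eq_smul_one, map_ofNat]
  simp only [e, smul_mul_assoc, one_mul] at h11 h12 h21 h22
  have hJ : (a • 1 + b • B + c • C - (a - 2 * b + c) • 1) *
      (a • 1 + b • B + c • C - (a + b - 2 * c) • 1) =
      (4 * b ^ 2 + 5 * b * c + c ^ 2) • (1 + B + C) := by
    simp only [mul_add, add_mul, mul_sub, sub_mul, smul_mul_assoc, mul_smul_comm, one_mul,
      mul_one, h11, h12, h21, h22]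
    module
  rw [hJ]
  simp only [mul_add, add_mul, sub_mul, smul_mul_assoc, mul_smul_comm, one_mul,
    mul_one, h11, h12, h21, h22]
  module

/-- The set of real eigenvalues of the symmetric diagram matrix `A^{5,3}` (case
`s = 3`, `r = 2`) is exactly `{x₂ + 6x₁ + 3x₀, x₂ - 2x₁ + x₀, x₂ + x₁ - 2x₀}`. -/
theorem stmt_16 (x : ℕ → ℝ)
    (A : Matrix {S : Finset (Fin 5) // S.card = 3}
                {S : Finset (Fin 5) // S.card = 3} ℝ)
    (hA : ∀ S T, A S T = x (2 - (S.val \ T.val).card)) :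
    ∀ μ : ℝ,
      (∃ v : {S : Finset (Fin 5) // S.card = 3} → ℝ, v ≠ 0 ∧ A.mulVec v = μ • v) ↔
      (μ = x 2 + 6 * x 1 + 3 * x 0 ∨ μ = x 2 - 2 * x 1 + x 0 ∨ μ = x 2 + x 1 - 2 * x 0) := by
  have hA' : A = x 2 • 1 + x 1 • (Int.castRingHom ℝ).mapMatrix (johnsonMatrix 1) +
      x 0 • (Int.castRingHom ℝ).mapMatrix (johnsonMatrix 2) := by
    rw [← map_one (Int.castRingHom ℝ).mapMatrix, ← johnsonMatrix_zero]
    ext S T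
    have h := card_sdiff_le_two S T
    simp only [hA, johnsonMatrix, Matrix.add_apply, Matrix.smul_apply, RingHom.mapMatrix_apply,
      Matrix.map_apply, Matrix.of_apply]
    generalize (S.val \ T.val).card = k at *
    interval_cases k <;> simp
  intro μ
  constructor
  · rintro ⟨v, hv, h⟩
    have shift (t : ℝ) : (A - t • 1).mulVec v = (μ - t) • v := by
      rw [Matrix.sub_mulVec, h, Matrix.smul_mulVec, Matrix.one_mulVec, sub_smul]
    have h0 := congrArg (fun M => M.mulVec v) (johnsonMatrix_annihilator (x 2) (x 1) (x 0))
    simp only [← hA', ← Matrix.mulVec_mulVec, shift, Matrix.mulVec_smul, Matrix.zero_mulVec,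
      smul_eq_zero, hv, or_false, sub_eq_zero] at h0
    tauto
  · rw [hA']
    rintro (rfl | rfl | rfl)
    · convert exists_eigenvector_of_johnsonMatrix (x 2) (x 1) (x 0) 1 6 3
        (by decide +kernel) (by decide +kernel) (by decide +kernel) using 5
      norm_num
    · convert exists_eigenvector_of_johnsonMatrix (x 2) (x 1) (x 0)
        (fun S => ((if 0 ∈ S.val then 1 else 0) - (if 1 ∈ S.val then 1 else 0)) *
          ((if 2 ∈ S.val then 1 else 0) - (if 3 ∈ S.val then 1 else 0))) (-2) 1
        (by decide +kernel) (by decide +kernel) (by decide +kernel) using 5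
      push_cast
      ring_nf
    · convert exists_eigenvector_of_johnsonMatrix (x 2) (x 1) (x 0)
        (fun S => (if 0 ∈ S.val then 1 else 0) - (if 1 ∈ S.val then 1 else 0)) 1 (-2)
        (by decide +kernel) (by decide +kernel) (by decide +kernel) using 5
      push_cast
      ring_nf
end

section
/- Let x_0, x_1, x_2, x_3 be real numbers and let A be the symmetric diagram matrix A^{7,4} (the case s = 4, r = 3): the 35×35 real matrix indexed by the 4-element subsets S, T of {1,…,7} whose (S,T)-entry is x_{3 − |S \ T|}. Then the set of real eigenvalues of A is exactly {x_3 + 12x_2 + 18x_1 + 4x_0, x_3 + 5x_2 − 3x_1 − 3x_0, x_3 − 3x_2 + 3x_1 − x_0, x_3 − 3x_1 + 2x_0}. -/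
/-- The four-element subsets of `Fin 7`, the vertices of the Johnson graph `J(7,4)`. -/
abbrev FourSubset := {S : Finset (Fin 7) // S.card = 4}

/-- The value at distance `d` of an integer multiple of the projection onto the `j`-th common
eigenspace of the Johnson scheme `J(7,4)`. -/
def johnsonProj (j : Fin 4) (d : ℕ) : ℤ :=
  (![![1, 1, 1, 1], ![12, 5, -2, -9], ![6, 0, -1, 3], ![12, -3, 2, -3]] j : Fin 4 → ℤ)
    (Fin.ofNat 4 d)

/-- The eigenvalue of the distance-`a` graph of `J(7,4)` on the `j`-th common eigenspace. -/
def johnsonEigenvalue (a j : Fin 4) : ℤ :=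
  (![![1, 1, 1, 1], ![12, 5, 0, -3], ![18, -3, -3, 3], ![4, -3, 2, -1]] a : Fin 4 → ℤ) j

lemma card_sdiff_le_three (S T : FourSubset) : (S.1 \ T.1).card ≤ 3 := by
  have h₁ := Finset.card_union_add_card_inter S.1 T.1
  have h₂ := Finset.card_sdiff_add_card_inter S.1 T.1
  have h₃ := Finset.card_le_univ (S.1 ∪ T.1)
  rw [S.2, T.2] at h₁
  rw [S.2] at h₂
  rw [Fintype.card_fin] at h₃
  omega

lemma card_sdiff_comm_fourSubset (S T : FourSubset) : (S.1 \ T.1).card = (T.1 \ S.1).card :=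
  Finset.card_sdiff_comm (S.2.trans T.2.symm)

/-- The permutation of the four-element subsets induced by a permutation of `Fin 7`. -/
def FourSubset.mapEquiv (σ : Equiv.Perm (Fin 7)) : Equiv.Perm FourSubset :=
  σ.finsetCongr.subtypeEquiv fun S => by simp

lemma FourSubset.card_mapEquiv_sdiff (σ : Equiv.Perm (Fin 7)) (S T : FourSubset) :
    ((mapEquiv σ S).1 \ (mapEquiv σ T).1).card = (S.1 \ T.1).card := by
  simp [mapEquiv, ← Finset.map_sdiff]

lemma FourSubset.exists_mapEquiv_eq (S T : FourSubset) : ∃ σ, mapEquiv σ S = T := by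
  let e : {x // x ∈ S.1} ≃ {x // x ∈ T.1} := Finset.equivOfCardEq (S.2.trans T.2.symm)
  refine ⟨e.extendSubtype, Subtype.ext (Finset.eq_of_subset_of_card_le ?_ ?_)⟩
  · intro y hy
    obtain ⟨z, hz, rfl⟩ := Finset.mem_map.mp hy
    exact e.extendSubtype_mem z hz
  · rw [T.2, (mapEquiv _ S).2]

/-- A four-element subset used as a base vertex of `J(7,4)`. -/
def FourSubset.base : FourSubset := ⟨{0, 1, 2, 3}, by decide⟩

lemma sum_johnsonProj_base (a j : Fin 4) (T : FourSubset) :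
    ∑ U : FourSubset with (FourSubset.base.1 \ U.1).card = a, johnsonProj j (U.1 \ T.1).card =
      johnsonEigenvalue a j * johnsonProj j (FourSubset.base.1 \ T.1).card := by
  revert a j T
  decide +kernel

lemma sum_johnsonProj (a j : Fin 4) (S T : FourSubset) :
    ∑ U : FourSubset with (S.1 \ U.1).card = a, johnsonProj j (U.1 \ T.1).card =
      johnsonEigenvalue a j * johnsonProj j (S.1 \ T.1).card := by
  obtain ⟨σ, hσ⟩ := FourSubset.exists_mapEquiv_eq S FourSubset.base
  have h := sum_johnsonProj_base a j (FourSubset.mapEquiv σ T)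
  rw [← hσ, FourSubset.card_mapEquiv_sdiff, Finset.sum_filter,
    ← Equiv.sum_comp (FourSubset.mapEquiv σ)] at h
  simpa only [FourSubset.card_mapEquiv_sdiff, Finset.sum_filter] using h

/-- The matrix of a multiple of the projection onto the `j`-th common eigenspace of `J(7,4)`. -/
def johnsonProjMatrix (j : Fin 4) : Matrix FourSubset FourSubset ℝ :=
  Matrix.of fun S T => (johnsonProj j (S.1 \ T.1).card : ℝ)

lemma johnsonProjMatrix_transpose (j : Fin 4) :
    (johnsonProjMatrix j).transpose = johnsonProjMatrix j := by
  ext S T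
  simp [johnsonProjMatrix, card_sdiff_comm_fourSubset S T]

lemma johnsonProjMatrix_apply_self (j : Fin 4) (S : FourSubset) :
    johnsonProjMatrix j S S ≠ 0 := by
  fin_cases j <;> simp [johnsonProjMatrix, johnsonProj]

lemma sum_johnsonProjMatrix :
    (6 : ℝ) • johnsonProjMatrix 0 + (3 : ℝ) • johnsonProjMatrix 1 + (14 : ℝ) • johnsonProjMatrix 2 +
      (7 : ℝ) • johnsonProjMatrix 3 = (210 : ℝ) • (1 : Matrix FourSubset FourSubset ℝ) := by
  have key : ∀ d < 4, 6 * johnsonProj 0 d + 3 * johnsonProj 1 d + 14 * johnsonProj 2 d +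
      7 * johnsonProj 3 d = if d = 0 then 210 else 0 := by
    decide
  ext S T
  have hST : (S.1 \ T.1).card = 0 ↔ S = T := by
    rw [Finset.card_eq_zero, Finset.sdiff_eq_empty_iff_subset]
    refine ⟨fun h => Subtype.ext (Finset.eq_of_subset_of_card_le h (T.2.trans S.2.symm).le), ?_⟩
    rintro rfl
    exact subset_rfl
  have h := congrArg (Int.cast : ℤ → ℝ) (key _ (Nat.lt_succ_of_le (card_sdiff_le_three S T)))
  push_cast at h
  simpa [johnsonProjMatrix, Matrix.one_apply, hST] using h

/-- The eigenvalue on the `j`-th common eigenspace of `J(7,4)` of the matrix whose value at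
distance `d` is `x (3 - d)`. -/
def diagramEigenvalue (x : ℕ → ℝ) (j : Fin 4) : ℝ :=
  ∑ a : Fin 4, x (3 - a) * johnsonEigenvalue a j

section

variable {x : ℕ → ℝ} {A : Matrix FourSubset FourSubset ℝ}

lemma mul_johnsonProjMatrix (hA : ∀ S T, A S T = x (3 - (S.val \ T.val).card)) (j : Fin 4) :
    A * johnsonProjMatrix j = diagramEigenvalue x j • johnsonProjMatrix j := by
  ext S T
  have hx : ∀ U, A S U = ∑ a : Fin 4, if (S.1 \ U.1).card = a then x (3 - a) else 0 := by
    intro U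
    have h := card_sdiff_le_three S U
    rw [hA, Finset.sum_eq_single ⟨(S.1 \ U.1).card, by omega⟩]
    · simp
    · intro b _ hb
      exact if_neg fun h' => hb (Fin.ext h'.symm)
    · simp
  simp only [Matrix.mul_apply, hx, Finset.sum_mul, Matrix.smul_apply, smul_eq_mul,
    diagramEigenvalue]
  rw [Finset.sum_comm]
  refine Finset.sum_congr rfl fun a _ => ?_
  have h := congrArg (Int.cast : ℤ → ℝ) (sum_johnsonProj a j S T)
  push_cast at h
  simp only [johnsonProjMatrix, Matrix.of_apply]
  rw [mul_assoc, ← h, Finset.mul_sum, Finset.sum_filter]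
  exact Finset.sum_congr rfl fun U _ => by split_ifs <;> simp

lemma johnsonProjMatrix_mul (hA : ∀ S T, A S T = x (3 - (S.val \ T.val).card)) (j : Fin 4) :
    johnsonProjMatrix j * A = diagramEigenvalue x j • johnsonProjMatrix j := by
  have hT : A.transpose = A := by
    ext S T
    rw [Matrix.transpose_apply, hA, hA, card_sdiff_comm_fourSubset]
  have h := congrArg Matrix.transpose (mul_johnsonProjMatrix hA j)
  rwa [Matrix.transpose_mul, Matrix.transpose_smul, johnsonProjMatrix_transpose, hT] at h

lemma exists_eigenvector_iff (hA : ∀ S T, A S T = x (3 - (S.val \ T.val).card)) (μ : ℝ) :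
    (∃ v : FourSubset → ℝ, v ≠ 0 ∧ A.mulVec v = μ • v) ↔ ∃ j, μ = diagramEigenvalue x j := by
  constructor
  · rintro ⟨v, hv, hAv⟩
    by_contra! hμ
    have hP : ∀ j, (johnsonProjMatrix j).mulVec v = 0 := by
      intro j
      have h : diagramEigenvalue x j • (johnsonProjMatrix j).mulVec v =
          μ • (johnsonProjMatrix j).mulVec v := by
        rw [← Matrix.smul_mulVec, ← johnsonProjMatrix_mul hA j, ← Matrix.mulVec_mulVec, hAv,
          Matrix.mulVec_smul]
      rw [← sub_eq_zero, ← sub_smul, smul_eq_zero, sub_eq_zero] at h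
      exact h.resolve_left (hμ j).symm
    have h := congrArg (fun M => M.mulVec v) sum_johnsonProjMatrix
    simp only [Matrix.add_mulVec, Matrix.smul_mulVec, hP, Matrix.one_mulVec] at h
    exact hv (by simpa using h.symm)
  · rintro ⟨j, rfl⟩
    refine ⟨(johnsonProjMatrix j).mulVec (Pi.single FourSubset.base 1), fun h => ?_, ?_⟩
    · have h₀ := congrFun h FourSubset.base
      rw [Matrix.mulVec_single_one] at h₀
      exact johnsonProjMatrix_apply_self j FourSubset.base h₀
    · rw [Matrix.mulVec_mulVec, mul_johnsonProjMatrix hA, Matrix.smul_mulVec]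

end


/-- The set of real eigenvalues of the symmetric diagram matrix `A^{7,4}` (case
`s = 4`, `r = 3`) is exactly
`{x₃ + 12x₂ + 18x₁ + 4x₀, x₃ + 5x₂ - 3x₁ - 3x₀, x₃ - 3x₂ + 3x₁ - x₀, x₃ - 3x₁ + 2x₀}`. -/
theorem stmt_17 (x : ℕ → ℝ)
    (A : Matrix {S : Finset (Fin 7) // S.card = 4}
                {S : Finset (Fin 7) // S.card = 4} ℝ)
    (hA : ∀ S T, A S T = x (3 - (S.val \ T.val).card)) :
    ∀ μ : ℝ,
      (∃ v : {S : Finset (Fin 7) // S.card = 4} → ℝ, v ≠ 0 ∧ A.mulVec v = μ • v) ↔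
      (μ = x 3 + 12 * x 2 + 18 * x 1 + 4 * x 0 ∨
       μ = x 3 + 5 * x 2 - 3 * x 1 - 3 * x 0 ∨
       μ = x 3 - 3 * x 2 + 3 * x 1 - x 0 ∨
       μ = x 3 - 3 * x 1 + 2 * x 0) := by
  intro μ
  rw [exists_eigenvector_iff hA, Fin.exists_fin_succ, Fin.exists_fin_succ, Fin.exists_fin_succ,
    Fin.exists_fin_one]
  have h0 : diagramEigenvalue x 0 = x 3 + 12 * x 2 + 18 * x 1 + 4 * x 0 := by
    simp [diagramEigenvalue, johnsonEigenvalue, Fin.sum_univ_four]; ring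
  have h1 : diagramEigenvalue x 1 = x 3 + 5 * x 2 - 3 * x 1 - 3 * x 0 := by
    simp [diagramEigenvalue, johnsonEigenvalue, Fin.sum_univ_four]; ring
  have h2 : diagramEigenvalue x 2 = x 3 - 3 * x 1 + 2 * x 0 := by
    simp [diagramEigenvalue, johnsonEigenvalue, Fin.sum_univ_four]; ring
  have h3 : diagramEigenvalue x 3 = x 3 - 3 * x 2 + 3 * x 1 - x 0 := by
    simp [diagramEigenvalue, johnsonEigenvalue, Fin.sum_univ_four]; ring
  rw [← h0, ← h1, ← h2, ← h3, or_comm (a := μ = diagramEigenvalue x 3)]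
  rfl
end
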